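/- Let Ω be a finite set and P an ℓ-step probability distribution on Ω^ℓ with equal marginals π (with support all of Ω), with ρ(P) ≤ ρ < 1, and let ε ∈ [0,1). Then for all μ^{(1)},…,μ^{(ℓ)} ∈ (0,1] there exist k ∈ ℕ and δ > 0 (depending only on P, ε and μ^{(1)},…,μ^{(ℓ)}) such that for every n ≥ 1 and all functions f^{(1)},…,f^{(ℓ)} : Ωⁿ → [0,1], if E[f^{(j)}(X^{(j)})] = μ^{(j)} for each j and f^{(1)},…,f^{(ℓ)} are all ε-resilient up to size k, then E[∏_{j=1}^ℓ f^{(j)}(X^{(j)})] ≥ δ. -/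

import Mathlib

namespace SameSetHitting

/-- `P` is a probability distribution on a finite type. -/
def IsDist {α : Type} [Fintype α] (P : α → ℝ) : Prop :=
  (∀ x, 0 ≤ P x) ∧ ∑ x, P x = 1

open Classical in
/-- The `j`-th marginal of an `ℓ`-step distribution `P`. -/
noncomputable def marginal {Ω : Type} [Fintype Ω] {ℓ : ℕ}
    (P : (Fin ℓ → Ω) → ℝ) (j : Fin ℓ) (a : Ω) : ℝ :=
  ∑ x : Fin ℓ → Ω, if x j = a then P x else 0

/-- All `ℓ` marginals of `P` are equal to `π`. -/
def HasMarginals {Ω : Type} [Fintype Ω] {ℓ : ℕ}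
    (P : (Fin ℓ → Ω) → ℝ) (π : Ω → ℝ) : Prop :=
  ∀ j a, marginal P j a = π a

/-- The expectation `E[f(X)]` where `X` has the product law `πⁿ`. -/
noncomputable def exps {Ω : Type} [Fintype Ω] {n : ℕ}
    (π : Ω → ℝ) (f : (Fin n → Ω) → ℝ) : ℝ :=
  ∑ v : Fin n → Ω, (∏ i, π (v i)) * f v

/-- `E[∏_{j} f_j(X^{(j)})]` where the tuples `(X_i^{(1)}, …, X_i^{(ℓ)})`,
`i = 1, …, n`, are i.i.d. with law `P` and `X^{(j)} = (X_1^{(j)}, …, X_n^{(j)})`. -/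
noncomputable def prodExp {Ω : Type} [Fintype Ω] {ℓ n : ℕ}
    (P : (Fin ℓ → Ω) → ℝ) (f : Fin ℓ → ((Fin n → Ω) → ℝ)) : ℝ :=
  ∑ x : Fin ℓ → Fin n → Ω, (∏ i, P (fun j => x j i)) * ∏ j, f j (x j)

/-- Expectation under the single-coordinate multi-step distribution `P`. -/
noncomputable def expP {Ω : Type} [Fintype Ω] {ℓ : ℕ}
    (P : (Fin ℓ → Ω) → ℝ) (f : (Fin ℓ → Ω) → ℝ) : ℝ :=
  ∑ x, P x * f x

/-- Covariance under `P`. -/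
noncomputable def covP {Ω : Type} [Fintype Ω] {ℓ : ℕ}
    (P : (Fin ℓ → Ω) → ℝ) (f g : (Fin ℓ → Ω) → ℝ) : ℝ :=
  expP P (fun x => f x * g x) - expP P f * expP P g

/-- Variance under `P`. -/
noncomputable def varP {Ω : Type} [Fintype Ω] {ℓ : ℕ}
    (P : (Fin ℓ → Ω) → ℝ) (f : (Fin ℓ → Ω) → ℝ) : ℝ :=
  covP P f f

/-- `f` depends only on the coordinates in `S`. -/
def DependsOn {Ω : Type} {ℓ : ℕ} (f : (Fin ℓ → Ω) → ℝ) (S : Finset (Fin ℓ)) : Prop :=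
  ∀ x y : Fin ℓ → Ω, (∀ j ∈ S, x j = y j) → f x = f y

/-- The correlation `ρ(P, S, T)`. -/
noncomputable def rhoST {Ω : Type} [Fintype Ω] {ℓ : ℕ}
    (P : (Fin ℓ → Ω) → ℝ) (S T : Finset (Fin ℓ)) : ℝ :=
  sSup {r : ℝ | ∃ f g : (Fin ℓ → Ω) → ℝ, DependsOn f S ∧ DependsOn g T ∧
    varP P f = 1 ∧ varP P g = 1 ∧ r = covP P f g}

/-- The correlation `ρ(P) = max_j ρ(P, {j}, [ℓ]∖{j})`. -/
noncomputable def rho {Ω : Type} [Fintype Ω] {ℓ : ℕ} (P : (Fin ℓ → Ω) → ℝ) : ℝ :=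
  ⨆ j : Fin ℓ, rhoST P {j} ({j}ᶜ)

/-- Expectation under the single-step distribution `π`. -/
noncomputable def expPi {Ω : Type} [Fintype Ω] (π : Ω → ℝ) (f : Ω → ℝ) : ℝ :=
  ∑ a, π a * f a

/-- Variance under the single-step distribution `π`. -/
noncomputable def varPi {Ω : Type} [Fintype Ω] (π : Ω → ℝ) (f : Ω → ℝ) : ℝ :=
  expPi π (fun a => (f a - expPi π f) ^ 2)

/-- The influence `Inf_i(f(X))` of coordinate `i`, where `X` has product law `πⁿ`. -/
noncomputable def influence {Ω : Type} [Fintype Ω] {n : ℕ}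
    (π : Ω → ℝ) (i : Fin n) (f : (Fin n → Ω) → ℝ) : ℝ :=
  ∑ v : Fin n → Ω, (∏ k, π (v k)) * varPi π (fun a => f (Function.update v i a))

/-- The function obtained from `f` by applying the restriction `R`
(`none` means unrestricted). -/
def restrict {Ω : Type} {n : ℕ} (R : Fin n → Option Ω)
    (f : (Fin n → Ω) → ℝ) : (Fin n → Ω) → ℝ :=
  fun x => f (fun i => (R i).getD (x i))

/-- The size (number of restricted coordinates) of a restriction. -/
def restSize {Ω : Type} {n : ℕ} (R : Fin n → Option Ω) : ℕ :=
  (Finset.univ.filter (fun i => (R i).isSome = true)).card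

/-- `f` is `ε`-resilient up to size `k` (with respect to the product law `πⁿ`). -/
def Resilient {Ω : Type} [Fintype Ω] {n : ℕ} (π : Ω → ℝ) (ε : ℝ) (k : ℕ)
    (f : (Fin n → Ω) → ℝ) : Prop :=
  ∀ R : Fin n → Option Ω, restSize R ≤ k →
    (1 - ε) * exps π f ≤ exps π (restrict R f) ∧
    exps π (restrict R f) ≤ (1 + ε) * exps π f

/-- The restriction operator `R[i,a]`. -/
def restrOp {Ω : Type} {n : ℕ} (i : Fin n) (a : Ω)
    (f : (Fin n → Ω) → ℝ) : (Fin n → Ω) → ℝ :=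
  fun x => f (Function.update x i a)

/-- The maximum operator `M[i,y,z]`. -/
def maxOp {Ω : Type} {n : ℕ} (i : Fin n) (y z : Ω)
    (f : (Fin n → Ω) → ℝ) : (Fin n → Ω) → ℝ :=
  fun x => max (f (Function.update x i y)) (f (Function.update x i z))

/-- Insert the value `a` at position `j` into `w : Ω^{[ℓ] ∖ {j}}`. -/
def ins {Ω : Type} {ℓ : ℕ} (j : Fin ℓ) (w : {k : Fin ℓ // k ≠ j} → Ω) (a : Ω) :
    Fin ℓ → Ω :=
  fun k => if h : k = j then a else w ⟨k, h⟩

/-- The probability that the coordinates other than `j` equal `w`. -/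
noncomputable def margOff {Ω : Type} [Fintype Ω] {ℓ : ℕ}
    (P : (Fin ℓ → Ω) → ℝ) (j : Fin ℓ) (w : {k : Fin ℓ // k ≠ j} → Ω) : ℝ :=
  ∑ a, P (ins j w a)

open Classical in
/-- The joint law of `(Y, Z)` for a double sample on step `j` from `P`. -/
noncomputable def doubleSample {Ω : Type} [Fintype Ω] {ℓ : ℕ}
    (P : (Fin ℓ → Ω) → ℝ) (j : Fin ℓ) (y z : Ω) : ℝ :=
  ∑ w : {k : Fin ℓ // k ≠ j} → Ω,
    if margOff P j w = 0 then 0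
    else P (ins j w y) * P (ins j w z) / margOff P j w


lemma sum_cons {α : Type} [Fintype α] {n : ℕ} (F : (Fin (n+1) → α) → ℝ) :
    ∑ v, F v = ∑ a, ∑ v : Fin n → α, F (Fin.cons a v) := by
  rw [← (Fin.consEquiv (fun _ => α)).sum_comp, Fintype.sum_prod_type]
  rfl

section Basic
variable {α β : Type} [Fintype α] [Fintype β] {n : ℕ}

lemma exps_succ (p : α → ℝ) (f : (Fin (n+1) → α) → ℝ) :
    exps p f = ∑ a, p a * exps p (fun v => f (Fin.cons a v)) := by
  unfold exps
  rw [sum_cons]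
  refine Finset.sum_congr rfl fun a _ => ?_
  rw [Finset.mul_sum]
  refine Finset.sum_congr rfl fun v _ => ?_
  rw [Fin.prod_univ_succ]
  simp [mul_assoc]

lemma exps_zero (p : α → ℝ) (f : (Fin 0 → α) → ℝ) : exps p f = f default := by
  unfold exps
  rw [Fintype.sum_unique]
  simp

lemma exps_add (p : α → ℝ) (f g : (Fin n → α) → ℝ) :
    exps p (fun v => f v + g v) = exps p f + exps p g := by
  simp [exps, mul_add, Finset.sum_add_distrib]

lemma exps_sub (p : α → ℝ) (f g : (Fin n → α) → ℝ) :
    exps p (fun v => f v - g v) = exps p f - exps p g := by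
  simp [exps, mul_sub, Finset.sum_sub_distrib]

lemma exps_const_mul (p : α → ℝ) (c : ℝ) (f : (Fin n → α) → ℝ) :
    exps p (fun v => c * f v) = c * exps p f := by
  simp only [exps, Finset.mul_sum]
  exact Finset.sum_congr rfl fun v _ => by ring

lemma exps_sum {ι : Type} (s : Finset ι) (p : α → ℝ) (f : ι → (Fin n → α) → ℝ) :
    exps p (fun v => ∑ i ∈ s, f i v) = ∑ i ∈ s, exps p (f i) := by
  simp only [exps, Finset.mul_sum]
  exact Finset.sum_comm

lemma exps_mono {p : α → ℝ} (hp : ∀ a, 0 ≤ p a) {f g : (Fin n → α) → ℝ} (h : ∀ v, f v ≤ g v) :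
    exps p f ≤ exps p g :=
  Finset.sum_le_sum fun v _ =>
    mul_le_mul_of_nonneg_left (h v) (Finset.prod_nonneg fun i _ => hp _)

lemma exps_nonneg {p : α → ℝ} (hp : ∀ a, 0 ≤ p a) {f : (Fin n → α) → ℝ} (h : ∀ v, 0 ≤ f v) :
    0 ≤ exps p f :=
  Finset.sum_nonneg fun v _ => mul_nonneg (Finset.prod_nonneg fun i _ => hp _) (h v)

lemma exps_const {p : α → ℝ} (hp : ∑ a, p a = 1) (c : ℝ) :
    exps p (fun _ : Fin n → α => c) = c := by
  induction n with
  | zero => rw [exps_zero]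
  | succ n ih => rw [exps_succ]; simp only [ih]; rw [← Finset.sum_mul, hp, one_mul]

lemma exps_cs {p : α → ℝ} (hp : ∀ a, 0 ≤ p a) (f g : (Fin n → α) → ℝ) :
    (exps p (fun v => f v * g v)) ^ 2 ≤ exps p (fun v => f v ^ 2) * exps p (fun v => g v ^ 2) := by
  unfold exps
  have hw : ∀ v : Fin n → α, 0 ≤ ∏ i, p (v i) := fun v => Finset.prod_nonneg fun i _ => hp _
  apply Finset.sum_sq_le_sum_mul_sum_of_sq_le_mul
  · intro v _; have := hw v; positivity
  · intro v _; have := hw v; positivity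
  · intro v _; apply le_of_eq; ring

/-- Tensor power of a kernel. -/
noncomputable def tens (K : β → α → ℝ) (f : (Fin n → α) → ℝ) (w : Fin n → β) : ℝ :=
  ∑ v : Fin n → α, (∏ i, K (w i) (v i)) * f v

lemma tens_cons (K : β → α → ℝ) (f : (Fin (n+1) → α) → ℝ) (b : β) (w : Fin n → β) :
    tens K f (Fin.cons b w) = ∑ a, K b a * tens K (fun v => f (Fin.cons a v)) w := by
  unfold tens
  rw [sum_cons]
  refine Finset.sum_congr rfl fun a _ => ?_
  rw [Finset.mul_sum]
  refine Finset.sum_congr rfl fun v _ => ?_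
  rw [Fin.prod_univ_succ]
  simp [mul_assoc]

lemma tens_zero (K : β → α → ℝ) (f : (Fin 0 → α) → ℝ) (w : Fin 0 → β) :
    tens K f w = f default := by
  unfold tens
  rw [Fintype.sum_unique]
  simp

lemma tens_add (K : β → α → ℝ) (f g : (Fin n → α) → ℝ) (w : Fin n → β) :
    tens K (fun v => f v + g v) w = tens K f w + tens K g w := by
  simp [tens, mul_add, Finset.sum_add_distrib]

lemma tens_sub (K : β → α → ℝ) (f g : (Fin n → α) → ℝ) (w : Fin n → β) :
    tens K (fun v => f v - g v) w = tens K f w - tens K g w := by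
  simp [tens, mul_sub, Finset.sum_sub_distrib]

lemma tens_const_mul (K : β → α → ℝ) (c : ℝ) (f : (Fin n → α) → ℝ) (w : Fin n → β) :
    tens K (fun v => c * f v) w = c * tens K f w := by
  simp only [tens, Finset.mul_sum]
  exact Finset.sum_congr rfl fun v _ => by ring

lemma tens_sum {ι : Type} (s : Finset ι) (K : β → α → ℝ) (f : ι → (Fin n → α) → ℝ)
    (w : Fin n → β) :
    tens K (fun v => ∑ i ∈ s, f i v) w = ∑ i ∈ s, tens K (f i) w := by
  simp only [tens, Finset.mul_sum]
  exact Finset.sum_comm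

lemma tens_mono {K : β → α → ℝ} (hK : ∀ b a, 0 ≤ K b a) {f g : (Fin n → α) → ℝ}
    (h : ∀ v, f v ≤ g v) (w : Fin n → β) : tens K f w ≤ tens K g w :=
  Finset.sum_le_sum fun v _ =>
    mul_le_mul_of_nonneg_left (h v) (Finset.prod_nonneg fun i _ => hK _ _)

lemma tens_weight_sum {K : β → α → ℝ} (hK1 : ∀ b, ∑ a, K b a = 1) (w : Fin n → β) :
    ∑ v : Fin n → α, (∏ i, K (w i) (v i)) = 1 := by
  classical
  have := Finset.prod_univ_sum (fun _ : Fin n => (Finset.univ : Finset α)) (fun i a => K (w i) a)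
  rw [Fintype.piFinset_univ] at this
  rw [← this]
  simp [hK1]

lemma tens_const {K : β → α → ℝ} (hK1 : ∀ b, ∑ a, K b a = 1) (c : ℝ) (w : Fin n → β) :
    tens K (fun _ : Fin n → α => c) w = c := by
  unfold tens
  rw [← Finset.sum_mul, tens_weight_sum hK1, one_mul]

lemma tens_sq_le {K : β → α → ℝ} (hK : ∀ b a, 0 ≤ K b a) (hK1 : ∀ b, ∑ a, K b a = 1)
    (f : (Fin n → α) → ℝ) (w : Fin n → β) :
    (tens K f w) ^ 2 ≤ tens K (fun v => f v ^ 2) w := by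
  have hw : ∀ v : Fin n → α, 0 ≤ ∏ i, K (w i) (v i) :=
    fun v => Finset.prod_nonneg fun i _ => hK _ _
  have := Finset.sum_sq_le_sum_mul_sum_of_sq_le_mul (Finset.univ : Finset (Fin n → α))
    (r := fun v => (∏ i, K (w i) (v i)) * f v) (f := fun v => ∏ i, K (w i) (v i))
    (g := fun v => (∏ i, K (w i) (v i)) * f v ^ 2) (fun v _ => hw v)
    (fun v _ => mul_nonneg (hw v) (sq_nonneg _)) (fun v _ => by apply le_of_eq; ring)
  rw [tens_weight_sum hK1, one_mul] at this
  exact this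

lemma tens_abs_le {K : β → α → ℝ} (hK : ∀ b a, 0 ≤ K b a) (hK1 : ∀ b, ∑ a, K b a = 1)
    {f : (Fin n → α) → ℝ} {c : ℝ} (h : ∀ v, |f v| ≤ c) (w : Fin n → β) : |tens K f w| ≤ c := by
  rw [abs_le]
  constructor
  · rw [← tens_const hK1 (-c) w]
    exact tens_mono hK (fun v => (abs_le.1 (h v)).1) w
  · rw [← tens_const hK1 c w]
    exact tens_mono hK (fun v => (abs_le.1 (h v)).2) w

lemma exps_tens {K : β → α → ℝ} {p : α → ℝ} {q : β → ℝ} (hqK : ∀ a, ∑ b, q b * K b a = p a)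
    (f : (Fin n → α) → ℝ) : exps q (tens K f) = exps p f := by
  induction n with
  | zero => rw [exps_zero, exps_zero, tens_zero]
  | succ n ih =>
    rw [exps_succ, exps_succ]
    simp only [tens_cons, exps_sum, exps_const_mul, ih, Finset.mul_sum]
    rw [Finset.sum_comm]
    refine Finset.sum_congr rfl fun a _ => ?_
    rw [← hqK a, Finset.sum_mul]
    exact Finset.sum_congr rfl fun b _ => by ring

lemma exps_tens_sq_le {K : β → α → ℝ} {p : α → ℝ} {q : β → ℝ} (hq : ∀ b, 0 ≤ q b)
    (hK : ∀ b a, 0 ≤ K b a) (hK1 : ∀ b, ∑ a, K b a = 1)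
    (hqK : ∀ a, ∑ b, q b * K b a = p a) (f : (Fin n → α) → ℝ) :
    exps q (fun w => tens K f w ^ 2) ≤ exps p (fun v => f v ^ 2) := by
  rw [← exps_tens hqK]
  exact exps_mono hq (tens_sq_le hK hK1 f)

lemma tens_tens {γ : Type} [Fintype γ] (K : γ → β → ℝ) (K' : β → α → ℝ) (K'' : γ → α → ℝ)
    (h : ∀ c a, ∑ b, K c b * K' b a = K'' c a) (f : (Fin n → α) → ℝ) (w : Fin n → γ) :
    tens K (tens K' f) w = tens K'' f w := by
  induction n with
  | zero => simp [tens_zero]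
  | succ n ih =>
    obtain ⟨c, w, rfl⟩ : ∃ c w', w = Fin.cons c w' := ⟨w 0, Fin.tail w, (Fin.cons_self_tail w).symm⟩
    rw [tens_cons, tens_cons]
    simp only [tens_cons, tens_sum, tens_const_mul, ih, Finset.mul_sum]
    rw [Finset.sum_comm]
    refine Finset.sum_congr rfl fun a _ => ?_
    rw [← h, Finset.sum_mul]
    exact Finset.sum_congr rfl fun b _ => by ring

lemma exps_selfadj {K : α → α → ℝ} {p : α → ℝ} (h : ∀ a b, p a * K a b = p b * K b a)
    (f g : (Fin n → α) → ℝ) :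
    exps p (fun v => tens K f v * g v) = exps p (fun v => f v * tens K g v) := by
  induction n with
  | zero => simp [exps_zero, tens_zero]
  | succ n ih =>
    rw [exps_succ, exps_succ]
    simp only [tens_cons, Finset.sum_mul, Finset.mul_sum, exps_sum]
    rw [Finset.sum_comm]
    refine Finset.sum_congr rfl fun a _ => ?_
    refine Finset.sum_congr rfl fun b _ => ?_
    have e1 : (fun v : Fin n → α => K b a * tens K (fun v => f (Fin.cons a v)) v * g (Fin.cons b v))
      = fun v => K b a * (tens K (fun v => f (Fin.cons a v)) v * g (Fin.cons b v)) := by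
      funext v; ring
    have e2 : (fun v : Fin n → α => f (Fin.cons a v) * (K a b * tens K (fun v => g (Fin.cons b v)) v))
      = fun v => K a b * (f (Fin.cons a v) * tens K (fun v => g (Fin.cons b v)) v) := by
      funext v; ring
    rw [e1, e2, exps_const_mul, exps_const_mul, ih (fun v => f (Fin.cons a v)) (fun v => g (Fin.cons b v)),
      ← mul_assoc, ← mul_assoc, h]

lemma exps_joint {K : β → α → ℝ} {Q : α × β → ℝ} {q : β → ℝ} (h : ∀ a b, q b * K b a = Q (a, b))
    (f : (Fin n → α) → ℝ) (g : (Fin n → β) → ℝ) :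
    exps Q (fun c => f (fun i => (c i).1) * g (fun i => (c i).2)) =
      exps q (fun w => tens K f w * g w) := by
  induction n with
  | zero =>
    rw [exps_zero, exps_zero, tens_zero]
    congr 2
    · exact Subsingleton.elim _ _
    · exact Subsingleton.elim _ _
  | succ n ih =>
    rw [exps_succ, exps_succ, Fintype.sum_prod_type_right]
    refine Finset.sum_congr rfl fun b _ => ?_
    simp only [tens_cons, Finset.sum_mul, exps_sum, Finset.mul_sum]
    refine Finset.sum_congr rfl fun a _ => ?_
    have e1 : ∀ c : Fin n → α × β, (fun i => ((Fin.cons (a, b) c : Fin (n+1) → α × β) i).1)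
        = (Fin.cons a (fun i => (c i).1) : Fin (n+1) → α) := by
      intro c; funext i; refine Fin.cases ?_ (fun i => ?_) i <;> simp
    have e2 : ∀ c : Fin n → α × β, (fun i => ((Fin.cons (a, b) c : Fin (n+1) → α × β) i).2)
        = (Fin.cons b (fun i => (c i).2) : Fin (n+1) → β) := by
      intro c; funext i; refine Fin.cases ?_ (fun i => ?_) i <;> simp
    simp only [e1, e2]
    rw [ih (fun v => f (Fin.cons a v)) (fun v => g (Fin.cons b v))]
    have e3 : (fun v : Fin n → β => K b a * tens K (fun v => f (Fin.cons a v)) v * g (Fin.cons b v))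
      = fun v => K b a * (tens K (fun v => f (Fin.cons a v)) v * g (Fin.cons b v)) := by
      funext v; ring
    rw [e3, exps_const_mul, ← mul_assoc, h]

end Basic

section Noise
variable {α : Type} [Fintype α] {n : ℕ}

open Classical in
/-- The noise kernel. -/
noncomputable def noise (r : ℝ) (p : α → ℝ) (x y : α) : ℝ :=
  (if x = y then r else 0) + (1 - r) * p y

lemma noise_nonneg {r : ℝ} {p : α → ℝ} (hp : ∀ a, 0 ≤ p a) (h0 : 0 ≤ r) (h1 : r ≤ 1) (x y : α) :
    0 ≤ noise r p x y := by
  unfold noise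
  have : 0 ≤ (1 - r) * p y := mul_nonneg (by linarith) (hp y)
  split_ifs <;> linarith

lemma sum_noise_mul (r : ℝ) (p : α → ℝ) (x : α) (F : α → ℝ) :
    ∑ a, noise r p x a * F a = r * F x + (1 - r) * ∑ a, p a * F a := by
  unfold noise
  simp only [add_mul, Finset.sum_add_distrib, ite_mul, zero_mul, Finset.mul_sum, mul_assoc]
  congr 1
  rw [Finset.sum_eq_single x]
  · simp
  · intro b _ hb; rw [if_neg (Ne.symm hb)]
  · intro h; exact absurd (Finset.mem_univ x) h

lemma noise_row {p : α → ℝ} (hp1 : ∑ a, p a = 1) (r : ℝ) (x : α) : ∑ a, noise r p x a = 1 := by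
  have := sum_noise_mul r p x (fun _ => 1)
  simp only [mul_one, hp1] at this
  rw [this]; ring

lemma noise_rev (r : ℝ) (p : α → ℝ) (a b : α) :
    p a * noise r p a b = p b * noise r p b a := by
  unfold noise
  by_cases h : a = b
  · subst h; rfl
  · rw [if_neg h, if_neg (Ne.symm h)]; ring

lemma noise_stat {p : α → ℝ} (hp1 : ∑ a, p a = 1) (r : ℝ) (a : α) :
    ∑ b, p b * noise r p b a = p a := by
  have : ∀ b, p b * noise r p b a = p a * noise r p a b := fun b => noise_rev r p b a
  simp only [this, ← Finset.mul_sum, noise_row hp1, mul_one]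

lemma noise_comp {p : α → ℝ} (hp1 : ∑ a, p a = 1) (r s : ℝ) (c a : α) :
    ∑ b, noise r p c b * noise s p b a = noise (r * s) p c a := by
  rw [sum_noise_mul, noise_stat hp1]
  unfold noise
  split_ifs <;> ring

lemma T_cons (r : ℝ) (p : α → ℝ) (f : (Fin (n+1) → α) → ℝ) (x : α) (v : Fin n → α) :
    tens (noise r p) f (Fin.cons x v) =
      tens (noise r p) (fun v => r * f (Fin.cons x v) + (1 - r) * ∑ a, p a * f (Fin.cons a v)) v := by
  rw [tens_cons, sum_noise_mul, tens_add, tens_const_mul, tens_const_mul, tens_sum]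
  simp only [tens_const_mul]

/-- The Laplacian in direction `i`. -/
noncomputable def lap (p : α → ℝ) (i : Fin n) (f : (Fin n → α) → ℝ) (v : Fin n → α) : ℝ :=
  f v - ∑ a, p a * f (Function.update v i a)

lemma lap_zero (p : α → ℝ) (f : (Fin (n+1) → α) → ℝ) (x : α) (v : Fin n → α) :
    lap p 0 f (Fin.cons x v) = f (Fin.cons x v) - ∑ a, p a * f (Fin.cons a v) := by
  unfold lap
  simp only [Fin.update_cons_zero]

lemma lap_succ (p : α → ℝ) (i : Fin n) (f : (Fin (n+1) → α) → ℝ) (x : α) (v : Fin n → α) :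
    lap p i.succ f (Fin.cons x v) = lap p i (fun v => f (Fin.cons x v)) v := by
  unfold lap
  simp only [Fin.cons_update]

lemma lap_lin (p : α → ℝ) (i : Fin n) (f : α → (Fin n → α) → ℝ) (c : α → ℝ) (v : Fin n → α) :
    lap p i (fun v => ∑ a, c a * f a v) v = ∑ a, c a * lap p i (f a) v := by
  unfold lap
  simp only [mul_sub, Finset.sum_sub_distrib, Finset.mul_sum]
  congr 1
  rw [Finset.sum_comm]
  exact Finset.sum_congr rfl fun a _ => Finset.sum_congr rfl fun b _ => by ring

lemma lap_add (p : α → ℝ) (i : Fin n) (f g : (Fin n → α) → ℝ) (c d : ℝ) (v : Fin n → α) :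
    lap p i (fun v => c * f v + d * g v) v = c * lap p i f v + d * lap p i g v := by
  unfold lap
  have : ∀ a, p a * (c * f (Function.update v i a) + d * g (Function.update v i a)) =
    c * (p a * f (Function.update v i a)) + d * (p a * g (Function.update v i a)) := fun a => by ring
  simp only [this, Finset.sum_add_distrib, ← Finset.mul_sum]
  ring

lemma lap_T {p : α → ℝ} (hp1 : ∑ a, p a = 1) (r : ℝ) (i : Fin n) (f : (Fin n → α) → ℝ)
    (v : Fin n → α) :
    lap p i (tens (noise r p) f) v = tens (noise r p) (lap p i f) v := by
  induction n with
  | zero => exact i.elim0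
  | succ n ih =>
    obtain ⟨x, v, rfl⟩ : ∃ c w', v = Fin.cons c w' := ⟨v 0, Fin.tail v, (Fin.cons_self_tail v).symm⟩
    refine Fin.cases ?_ (fun i => ?_) i
    · rw [lap_zero, T_cons, T_cons]
      simp only [T_cons, lap_zero]
      simp only [← tens_const_mul, ← tens_sum, ← tens_sub]
      congr 1
      funext v
      have e1 : ∑ a, p a * (r * f (Fin.cons a v) + (1 - r) * ∑ a, p a * f (Fin.cons a v))
          = ∑ a, p a * f (Fin.cons a v) := by
        have : ∀ a, p a * (r * f (Fin.cons a v) + (1 - r) * ∑ a, p a * f (Fin.cons a v))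
          = r * (p a * f (Fin.cons a v)) + p a * ((1 - r) * ∑ a, p a * f (Fin.cons a v)) :=
          fun a => by ring
        simp only [this, Finset.sum_add_distrib]
        rw [← Finset.mul_sum, ← Finset.sum_mul, hp1]; ring
      have e2 : ∑ a, p a * (f (Fin.cons a v) - ∑ a, p a * f (Fin.cons a v)) = 0 := by
        simp only [mul_sub, Finset.sum_sub_distrib]
        rw [← Finset.sum_mul, hp1]; ring
      rw [e1, e2]; ring
    · rw [lap_succ, T_cons]
      simp only [T_cons, lap_succ]
      rw [ih]
      congr 1
      funext v
      rw [lap_add, lap_lin]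

/-- variance decomposition -/
lemma var_decomp {p : α → ℝ} (hp1 : ∑ a, p a = 1) (s : ℝ) (F : α → ℝ) :
    ∑ x, p x * (s * F x + (1 - s) * ∑ a, p a * F a) ^ 2 =
      (∑ a, p a * F a) ^ 2 + s ^ 2 * ∑ x, p x * (F x - ∑ a, p a * F a) ^ 2 := by
  set m := ∑ a, p a * F a with hm
  have h0 : ∑ x, p x * (F x - m) = 0 := by
    simp only [mul_sub, Finset.sum_sub_distrib]
    rw [← Finset.sum_mul, hp1, ← hm]; ring
  have : ∀ x, p x * (s * F x + (1 - s) * m) ^ 2 =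
      p x * m ^ 2 + 2 * m * s * (p x * (F x - m)) + s ^ 2 * (p x * (F x - m) ^ 2) := fun x => by ring
  simp only [this, Finset.sum_add_distrib, ← Finset.mul_sum, h0]
  rw [← Finset.sum_mul, hp1]; ring

lemma exps_sq_decomp {p : α → ℝ} (hp1 : ∑ a, p a = 1) (s : ℝ) (f : (Fin (n+1) → α) → ℝ) :
    ∑ x, p x * exps p (fun v => (s * f (Fin.cons x v) + (1 - s) * ∑ a, p a * f (Fin.cons a v)) ^ 2)
    = exps p (fun v => (∑ a, p a * f (Fin.cons a v)) ^ 2) +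
      s ^ 2 * ∑ x, p x * exps p (fun v => (f (Fin.cons x v) - ∑ a, p a * f (Fin.cons a v)) ^ 2) := by
  simp only [← exps_const_mul, ← exps_sum, ← exps_add]
  congr 1
  funext v
  rw [var_decomp hp1 s (fun a => f (Fin.cons a v))]

lemma exps_sq_decomp1 {p : α → ℝ} (hp1 : ∑ a, p a = 1) (f : (Fin (n+1) → α) → ℝ) :
    exps p (fun v => f v ^ 2)
    = exps p (fun v => (∑ a, p a * f (Fin.cons a v)) ^ 2) +
      ∑ x, p x * exps p (fun v => (f (Fin.cons x v) - ∑ a, p a * f (Fin.cons a v)) ^ 2) := by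
  have := exps_sq_decomp hp1 1 f
  rw [one_pow, one_mul] at this
  rw [← this, exps_succ]
  simp

lemma energy {p : α → ℝ} (hp : ∀ a, 0 ≤ p a) (hp1 : ∑ a, p a = 1) {r : ℝ} (h0 : 0 ≤ r) (h1 : r < 1)
    (f : (Fin n → α) → ℝ) :
    ∑ i, exps p (fun v => lap p i (tens (noise r p) f) v ^ 2)
      ≤ (1 / (1 - r ^ 2)) * exps p (fun v => f v ^ 2) := by
  have hr2 : 0 < 1 - r ^ 2 := by nlinarith
  induction n with
  | zero =>
    simp only [Finset.univ_eq_empty, Finset.sum_empty]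
    exact mul_nonneg (by positivity) (exps_nonneg hp fun v => sq_nonneg _)
  | succ n ih =>
    rw [Fin.sum_univ_succ]
    set C := 1 / (1 - r ^ 2) with hC
    have hC' : C * r ^ 2 + r ^ 2 ≤ C := by
      have : C * (1 - r ^ 2) = 1 := by rw [hC]; field_simp
      nlinarith
    set A := exps p (fun v => (∑ a, p a * f (Fin.cons a v)) ^ 2) with hA
    set B := ∑ x, p x * exps p (fun v => (f (Fin.cons x v) - ∑ a, p a * f (Fin.cons a v)) ^ 2) with hB
    have hA0 : 0 ≤ A := exps_nonneg hp fun v => sq_nonneg _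
    have hB0 : 0 ≤ B := Finset.sum_nonneg fun x _ => mul_nonneg (hp x) (exps_nonneg hp fun v => sq_nonneg _)
    have step0 : exps p (fun v => lap p 0 (tens (noise r p) f) v ^ 2) ≤ r ^ 2 * B := by
      rw [exps_succ, hB, Finset.mul_sum]
      refine Finset.sum_le_sum fun x _ => ?_
      rw [mul_left_comm]
      refine mul_le_mul_of_nonneg_left ?_ (hp x)
      have e : ∀ v : Fin n → α, lap p 0 (tens (noise r p) f) (Fin.cons x v)
          = r * tens (noise r p) (fun v => f (Fin.cons x v) - ∑ a, p a * f (Fin.cons a v)) v := by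
        intro v
        rw [lap_T hp1, T_cons, ← tens_const_mul]
        congr 1
        funext v
        simp only [lap_zero]
        have e2 : ∑ a, p a * (f (Fin.cons a v) - ∑ a, p a * f (Fin.cons a v)) = 0 := by
          simp only [mul_sub, Finset.sum_sub_distrib]
          rw [← Finset.sum_mul, hp1]; ring
        rw [e2]; ring
      simp only [e, mul_pow, exps_const_mul]
      refine mul_le_mul_of_nonneg_left ?_ (sq_nonneg r)
      exact exps_tens_sq_le hp (noise_nonneg hp h0 h1.le) (noise_row hp1 r) (noise_stat hp1 r) _
    have step1 : ∑ i : Fin n, exps p (fun v => lap p i.succ (tens (noise r p) f) v ^ 2)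
        ≤ C * (A + r ^ 2 * B) := by
      rw [hA, hB, ← exps_sq_decomp hp1 r f, Finset.mul_sum]
      have es : ∀ i : Fin n, exps p (fun v => lap p i.succ (tens (noise r p) f) v ^ 2) =
        ∑ x, p x * exps p (fun v => lap p i.succ (tens (noise r p) f) (Fin.cons x v) ^ 2) :=
        fun i => exps_succ p _
      simp only [es]
      rw [Finset.sum_comm]
      refine Finset.sum_le_sum fun x _ => ?_
      rw [← Finset.mul_sum, mul_left_comm]
      refine mul_le_mul_of_nonneg_left ?_ (hp x)
      refine le_trans (le_of_eq ?_) (ih _)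
      refine Finset.sum_congr rfl fun i _ => ?_
      congr 1
      funext v
      rw [lap_succ]
      simp only [T_cons]
    rw [exps_sq_decomp1 hp1 f]
    nlinarith

lemma quart_aux (a b s : ℝ) : (a + s * b) ^ 4 ≤
    a ^ 4 + 4 * a ^ 3 * s * b + 8 * s ^ 2 * (a ^ 2 * b ^ 2) + 3 * s ^ 4 * b ^ 4 := by
  nlinarith [sq_nonneg (s * a * b - s ^ 2 * b ^ 2)]

lemma hyper {p : α → ℝ} {l : ℝ} (hl : 0 < l) (hp : ∀ a, l ≤ p a) (hp1 : ∑ a, p a = 1) {s : ℝ}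
    (hs : 8 * s ^ 2 ≤ 2) (hs' : 3 * s ^ 4 ≤ l) (f : (Fin n → α) → ℝ) :
    exps p (fun v => tens (noise s p) f v ^ 4) ≤ (exps p (fun v => f v ^ 2)) ^ 2 := by
  have hp0 : ∀ a, 0 ≤ p a := fun a => hl.le.trans (hp a)
  induction n with
  | zero => simp only [exps_zero, tens_zero]; apply le_of_eq; ring
  | succ n ih =>
    rw [exps_sq_decomp1 hp1 f]
    set m : (Fin n → α) → ℝ := fun v => ∑ a, p a * f (Fin.cons a v) with hm
    set d : α → (Fin n → α) → ℝ := fun x v => f (Fin.cons x v) - m v with hd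
    set A := exps p (fun v => m v ^ 2) with hA
    set D : α → ℝ := fun x => exps p (fun v => d x v ^ 2) with hD
    have hD0 : ∀ x, 0 ≤ D x := fun x => exps_nonneg hp0 fun v => sq_nonneg _
    have hA0 : 0 ≤ A := exps_nonneg hp0 fun v => sq_nonneg _
    set B := ∑ x, p x * D x with hB
    have hB0 : 0 ≤ B := Finset.sum_nonneg fun x _ => mul_nonneg (hp0 x) (hD0 x)
    have hDB : ∀ x, l * D x ≤ B := fun x =>
      (mul_le_mul_of_nonneg_right (hp x) (hD0 x)).trans
        (Finset.single_le_sum (f := fun x => p x * D x)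
          (fun y _ => mul_nonneg (hp0 y) (hD0 y)) (Finset.mem_univ x))
    have hDD : l * ∑ x, p x * D x ^ 2 ≤ B ^ 2 := by
      rw [Finset.mul_sum]
      calc ∑ x, l * (p x * D x ^ 2) ≤ ∑ x, B * (p x * D x) := by
            refine Finset.sum_le_sum fun x _ => ?_
            have := mul_le_mul_of_nonneg_right (hDB x) (mul_nonneg (hp0 x) (hD0 x))
            nlinarith
        _ = B ^ 2 := by rw [← Finset.mul_sum, ← hB]; ring
    -- pointwise
    have hT : ∀ x v, tens (noise s p) f (Fin.cons x v) =
        tens (noise s p) m v + s * tens (noise s p) (d x) v := by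
      intro x v
      rw [T_cons, ← tens_const_mul, ← tens_add]
      congr 1; funext v; simp only [hd, hm]; ring
    have hb0 : ∀ v, ∑ x, p x * tens (noise s p) (d x) v = 0 := by
      intro v
      simp only [← tens_const_mul, ← tens_sum]
      have : (fun v => ∑ x, p x * d x v) = fun _ : Fin n → α => (0:ℝ) := by
        funext v
        simp only [hd, mul_sub, Finset.sum_sub_distrib]
        rw [← Finset.sum_mul, hp1, hm]; simp
      rw [this, tens_const (noise_row hp1 s)]
    have hpt : ∀ v, ∑ x, p x * tens (noise s p) f (Fin.cons x v) ^ 4 ≤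
        tens (noise s p) m v ^ 4 +
        8 * s ^ 2 * ∑ x, p x * (tens (noise s p) m v ^ 2 * tens (noise s p) (d x) v ^ 2) +
        3 * s ^ 4 * ∑ x, p x * tens (noise s p) (d x) v ^ 4 := by
      intro v
      set a := tens (noise s p) m v with ha
      calc ∑ x, p x * tens (noise s p) f (Fin.cons x v) ^ 4
          ≤ ∑ x, (p x * a ^ 4 + 4 * a ^ 3 * s * (p x * tens (noise s p) (d x) v)
              + 8 * s ^ 2 * (p x * (a ^ 2 * tens (noise s p) (d x) v ^ 2))
              + 3 * s ^ 4 * (p x * tens (noise s p) (d x) v ^ 4)) := by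
            refine Finset.sum_le_sum fun x _ => ?_
            rw [hT x v]
            have := mul_le_mul_of_nonneg_left (quart_aux a (tens (noise s p) (d x) v) s) (hp0 x)
            linarith
        _ = _ := by
            simp only [Finset.sum_add_distrib, ← Finset.mul_sum, hb0]
            rw [← Finset.sum_mul, hp1]; ring
    have hcross : ∀ x, exps p (fun v => tens (noise s p) m v ^ 2 * tens (noise s p) (d x) v ^ 2)
        ≤ A * D x := by
      intro x
      have h1 := exps_cs hp0 (fun v => tens (noise s p) m v ^ 2) (fun v => tens (noise s p) (d x) v ^ 2)
      have h2 := ih m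
      have h3 := ih (d x)
      simp only [← pow_mul] at h1
      norm_num at h1
      have h4 : (exps p fun v => tens (noise s p) m v ^ 2 * tens (noise s p) (d x) v ^ 2) ^ 2
          ≤ (A * D x) ^ 2 := by
        rw [mul_pow]
        exact h1.trans (mul_le_mul h2 h3 (exps_nonneg hp0 fun v => by positivity) (by positivity))
      exact abs_le_of_sq_le_sq' h4 (mul_nonneg hA0 (hD0 x)) |>.2
    calc exps p (fun v => tens (noise s p) f v ^ 4)
        = exps p (fun v => ∑ x, p x * tens (noise s p) f (Fin.cons x v) ^ 4) := by
          rw [exps_succ, exps_sum]; simp only [exps_const_mul]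
      _ ≤ _ := exps_mono hp0 hpt
      _ = exps p (fun v => tens (noise s p) m v ^ 4) +
          8 * s ^ 2 * ∑ x, p x * exps p (fun v => tens (noise s p) m v ^ 2 * tens (noise s p) (d x) v ^ 2)
          + 3 * s ^ 4 * ∑ x, p x * exps p (fun v => tens (noise s p) (d x) v ^ 4) := by
          rw [exps_add, exps_add, exps_const_mul, exps_const_mul, exps_sum, exps_sum]
          simp only [exps_const_mul]
      _ ≤ A ^ 2 + 8 * s ^ 2 * ∑ x, p x * (A * D x) + 3 * s ^ 4 * ∑ x, p x * D x ^ 2 := by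
          gcongr with x _ x _
          · exact ih m
          · exact hp0 x
          · exact hcross x
          · exact hp0 x
          · exact ih (d x)
      _ = A ^ 2 + 8 * s ^ 2 * (A * B) + 3 * s ^ 4 * ∑ x, p x * D x ^ 2 := by
          have : ∑ x, p x * (A * D x) = A * B := by
            rw [hB, Finset.mul_sum]
            exact Finset.sum_congr rfl fun x _ => by ring
          rw [this]
      _ ≤ (A + B) ^ 2 := by
          have hS : 0 ≤ ∑ x, p x * D x ^ 2 :=
            Finset.sum_nonneg fun x _ => mul_nonneg (hp0 x) (sq_nonneg _)
          have := mul_le_mul_of_nonneg_right hs (mul_nonneg hA0 hB0)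
          have := mul_le_mul_of_nonneg_right hs' hS
          nlinarith

end Noise

section Third
variable {α : Type} [Fintype α] {n : ℕ}

lemma T_sq_adj {p : α → ℝ} (hp1 : ∑ a, p a = 1) (r : ℝ) (b : (Fin n → α) → ℝ) :
    exps p (fun v => tens (noise r p) b v ^ 2) =
      exps p (fun v => b v * tens (noise (r * r) p) b v) := by
  have e : (fun v => tens (noise r p) b v ^ 2) =
      fun v => tens (noise r p) b v * (tens (noise r p) b) v := by funext v; ring
  rw [e, exps_selfadj (noise_rev r p)]
  congr 1; funext v
  rw [tens_tens _ _ _ (noise_comp hp1 r r)]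

lemma logconv {p : α → ℝ} (hp : ∀ a, 0 ≤ p a) (hp1 : ∑ a, p a = 1) (r : ℝ)
    (b : (Fin n → α) → ℝ) (j : ℕ) :
    exps p (fun v => tens (noise r p) b v ^ 2) ^ (2 ^ j) * exps p (fun v => b v ^ 2) ≤
      exps p (fun v => b v ^ 2) ^ (2 ^ j) *
        exps p (fun v => tens (noise (r ^ (2 ^ j)) p) b v ^ 2) := by
  induction j with
  | zero => simp only [pow_zero, pow_one]; rw [mul_comm]
  | succ j ih =>
    set N := exps p (fun v => b v ^ 2) with hN
    set X := exps p (fun v => tens (noise r p) b v ^ 2) with hX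
    have hN0 : 0 ≤ N := exps_nonneg hp fun v => sq_nonneg _
    have hX0 : 0 ≤ X := exps_nonneg hp fun v => sq_nonneg _
    set Y := exps p (fun v => tens (noise (r ^ (2 ^ j)) p) b v ^ 2) with hY
    set Z := exps p (fun v => tens (noise (r ^ (2 ^ (j+1))) p) b v ^ 2) with hZ
    have hY2 : Y ^ 2 ≤ N * Z := by
      rw [hY, T_sq_adj hp1, ← pow_add, ← two_mul, ← pow_succ']
      exact exps_cs hp _ _
    rcases hN0.eq_or_lt with h | h
    · rw [← h]; simp
    · have h2 := pow_le_pow_left₀ (by positivity) ih 2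
      rw [mul_pow, mul_pow, ← pow_mul, ← pow_mul, ← pow_succ] at h2
      have h3 : X ^ (2 ^ (j+1)) * N * N ≤ N ^ (2 ^ (j+1)) * Z * N := by
        calc _ = X ^ (2 ^ (j+1)) * N ^ 2 := by ring
          _ ≤ _ := h2
          _ ≤ N ^ (2 ^ (j+1)) * (N * Z) := by gcongr
          _ = _ := by ring
      exact le_of_mul_le_mul_right h3 h

lemma smallset {p : α → ℝ} {l : ℝ} (hl : 0 < l) (hp : ∀ a, l ≤ p a) (hp1 : ∑ a, p a = 1) {s : ℝ}
    (hs : 8 * s ^ 2 ≤ 2) (hs' : 3 * s ^ 4 ≤ l) (b χ : (Fin n → α) → ℝ)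
    (hχ : ∀ v, χ v ^ 2 = χ v) (hb : ∀ v, b v = b v * χ v) :
    exps p (fun v => tens (noise s p) b v ^ 2) ^ 2 ≤
      exps p (fun v => b v ^ 2) ^ 2 * exps p χ := by
  have hp0 : ∀ a, 0 ≤ p a := fun a => hl.le.trans (hp a)
  have hχ0 : ∀ v, 0 ≤ χ v := fun v => by rw [← hχ]; positivity
  set Y := exps p (fun v => tens (noise s p) b v ^ 2) with hY
  set N := exps p (fun v => b v ^ 2) with hN
  have hN0 : 0 ≤ N := exps_nonneg hp0 fun v => sq_nonneg _
  have hY0 : 0 ≤ Y := exps_nonneg hp0 fun v => sq_nonneg _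
  have hc0 : 0 ≤ exps p χ := exps_nonneg hp0 hχ0
  set w := tens (noise s p) (tens (noise s p) b) with hw
  have h1 : Y = exps p (fun v => b v * (χ v * w v)) := by
    rw [hY, T_sq_adj hp1]
    congr 1; funext v
    rw [hw, tens_tens _ _ _ (noise_comp hp1 s s), ← mul_assoc, ← hb]
  have h2 : Y ^ 2 ≤ N * exps p (fun v => χ v * w v ^ 2) := by
    conv_lhs => rw [h1]
    refine (exps_cs hp0 _ _).trans (le_of_eq ?_)
    simp only [mul_pow, hχ]
    rfl
  have h3 : exps p (fun v => χ v * w v ^ 2) ^ 2 ≤ exps p χ * Y ^ 2 := by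
    refine (exps_cs hp0 _ _).trans ?_
    simp only [hχ, ← pow_mul]
    exact mul_le_mul_of_nonneg_left (hyper hl hp hp1 hs hs' (tens (noise s p) b)) hc0
  rcases hY0.eq_or_lt with h | h
  · rw [← h]; simp only [ne_eq, OfNat.ofNat_ne_zero, not_false_eq_true, zero_pow]; positivity
  · have h4 : Y ^ 2 * Y ^ 2 ≤ (N ^ 2 * exps p χ) * Y ^ 2 := by
      calc Y ^ 2 * Y ^ 2 = (Y ^ 2) ^ 2 := by ring
        _ ≤ (N * exps p (fun v => χ v * w v ^ 2)) ^ 2 := pow_le_pow_left₀ (by positivity) h2 2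
        _ = N ^ 2 * exps p (fun v => χ v * w v ^ 2) ^ 2 := by ring
        _ ≤ N ^ 2 * (exps p χ * Y ^ 2) := by gcongr
        _ = _ := by ring
    exact le_of_mul_le_mul_right h4 (by positivity)

lemma third {p : α → ℝ} {l : ℝ} (hl : 0 < l) (hp : ∀ a, l ≤ p a) (hp1 : ∑ a, p a = 1) {r : ℝ}
    (h0 : 0 ≤ r) (h1 : r < 1) {ξ : ℝ} (hξ : 0 < ξ) :
    ∃ τ : ℝ, 0 < τ ∧ ∀ (n : ℕ) (h : (Fin n → α) → ℝ), (∀ v, |h v| ≤ 1) →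
      exps p (fun v => h v ^ 2) ≤ τ →
      exps p (fun v => |tens (noise r p) h v| ^ 3) ≤ ξ * exps p (fun v => h v ^ 2) := by
  classical
  have hp0 : ∀ a, 0 ≤ p a := fun a => hl.le.trans (hp a)
  obtain ⟨k, hk⟩ := exists_pow_lt_of_lt_one (show 0 < min (1/2) (l/3) by positivity) h1
  set R := r ^ (2 ^ k) with hR
  have hRle : R ≤ min (1/2) (l/3) :=
    (pow_le_pow_of_le_one h0 h1.le (Nat.lt_two_pow_self (n := k)).le).trans hk.le
  have hR0 : 0 ≤ R := pow_nonneg h0 _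
  have hRh : R ≤ 1/2 := hRle.trans (min_le_left _ _)
  have hRl : R ≤ l/3 := hRle.trans (min_le_right _ _)
  have hs : 8 * R ^ 2 ≤ 2 := by nlinarith
  have hs' : 3 * R ^ 4 ≤ l := by
    have : R ^ 4 ≤ R := by
      calc R ^ 4 ≤ R ^ 1 := pow_le_pow_of_le_one hR0 (by linarith) (by norm_num)
        _ = R := pow_one R
    linarith
  set θ := ξ / 2 with hθ
  have hθ0 : 0 < θ := by positivity
  set M := 2 ^ k with hM
  refine ⟨θ ^ 2 * (θ ^ (2 * M)) ^ 2, by positivity, fun n h hh1 hτ => ?_⟩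
  set χ : (Fin n → α) → ℝ := fun v => if θ < |h v| then 1 else 0 with hχ
  set b : (Fin n → α) → ℝ := fun v => h v * χ v with hb
  have hχ2 : ∀ v, χ v ^ 2 = χ v := fun v => by simp only [hχ]; split_ifs <;> simp
  have hbχ : ∀ v, b v = b v * χ v := fun v => by
    simp only [hb]; rw [mul_assoc, ← pow_two, hχ2]
  set H := exps p (fun v => h v ^ 2) with hH
  have hH0 : 0 ≤ H := exps_nonneg hp0 fun v => sq_nonneg _
  set N := exps p (fun v => b v ^ 2) with hN
  have hN0 : 0 ≤ N := exps_nonneg hp0 fun v => sq_nonneg _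
  have hNH : N ≤ H := exps_mono hp0 fun v => by
    simp only [hb, hχ]; split_ifs <;> simp [sq_nonneg]
  have hEχ : θ ^ 2 * exps p χ ≤ H := by
    rw [← exps_const_mul]
    refine exps_mono hp0 fun v => ?_
    simp only [hχ]
    split_ifs with hc
    · rw [mul_one, ← sq_abs (h v)]; exact pow_le_pow_left₀ hθ0.le hc.le 2
    · rw [mul_zero]; positivity
  have hEχ' : exps p χ ≤ (θ ^ (2 * M)) ^ 2 := by
    have := hEχ.trans hτ
    exact le_of_mul_le_mul_left this (by positivity)
  set X := exps p (fun v => tens (noise r p) b v ^ 2) with hX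
  have hX0 : 0 ≤ X := exps_nonneg hp0 fun v => sq_nonneg _
  have hcontr : ∀ g : (Fin n → α) → ℝ, exps p (fun v => tens (noise r p) g v ^ 2) ≤
      exps p (fun v => g v ^ 2) := fun g =>
    exps_tens_sq_le hp0 (noise_nonneg hp0 h0 h1.le) (noise_row hp1 r) (noise_stat hp1 r) g
  have hXN : X ≤ θ ^ 2 * N := by
    rcases hN0.eq_or_lt with hz | hz
    · have := hcontr b
      rw [← hN, ← hz] at this
      rw [← hz]; linarith
    · have l1 := logconv hp0 hp1 r b k
      have l2 := smallset hl hp hp1 hs hs' b χ hχ2 hbχ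
      set Y := exps p (fun v => tens (noise R p) b v ^ 2) with hY
      have hY0 : 0 ≤ Y := exps_nonneg hp0 fun v => sq_nonneg _
      have l3 : Y ^ 2 ≤ (N * θ ^ (2 * M)) ^ 2 := by
        rw [mul_pow]
        exact l2.trans (mul_le_mul_of_nonneg_left hEχ' (by positivity))
      have l4 : Y ≤ N * θ ^ (2 * M) := abs_le_of_sq_le_sq' l3 (by positivity) |>.2
      have l5 : X ^ M * N ≤ (θ ^ 2 * N) ^ M * N := by
        calc X ^ M * N ≤ N ^ M * Y := l1
          _ ≤ N ^ M * (N * θ ^ (2 * M)) := by gcongr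
          _ = _ := by rw [mul_pow, ← pow_mul]; ring
      have l6 := le_of_mul_le_mul_right l5 hz
      exact le_of_pow_le_pow_left₀ (by positivity) (by positivity) l6
  have hcs : exps p (fun v => |tens (noise r p) h v| * |tens (noise r p) b v|) ≤ θ * H := by
    have c1 := exps_cs hp0 (fun v => |tens (noise r p) h v|) (fun v => |tens (noise r p) b v|)
    simp only [sq_abs] at c1
    have c2 : (exps p fun v => |tens (noise r p) h v| * |tens (noise r p) b v|) ^ 2 ≤ (θ * H) ^ 2 := by
      refine c1.trans ?_
      calc _ ≤ H * (θ ^ 2 * N) := mul_le_mul (hcontr h) hXN hX0 hH0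
        _ ≤ H * (θ ^ 2 * H) := by gcongr
        _ = _ := by ring
    exact abs_le_of_sq_le_sq' c2 (by positivity) |>.2
  have hpt : ∀ v, |tens (noise r p) h v| ^ 3 ≤
      θ * tens (noise r p) h v ^ 2 + |tens (noise r p) h v| * |tens (noise r p) b v| := by
    intro v
    have a1 : |tens (noise r p) h v| ≤ 1 :=
      tens_abs_le (noise_nonneg hp0 h0 h1.le) (noise_row hp1 r) hh1 v
    have a2 : |tens (noise r p) (fun v => h v - b v) v| ≤ θ := by
      refine tens_abs_le (noise_nonneg hp0 h0 h1.le) (noise_row hp1 r) (fun v => ?_) v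
      simp only [hb, hχ]
      split_ifs with hc
      · simp [hθ0.le]
      · simpa using hc
    rw [tens_sub] at a2
    have a3 : |tens (noise r p) h v| ≤ θ + |tens (noise r p) b v| := by
      have := abs_sub_abs_le_abs_sub (tens (noise r p) h v) (tens (noise r p) b v)
      linarith
    rw [← sq_abs (tens (noise r p) h v)]
    have a4 := abs_nonneg (tens (noise r p) h v)
    have a5 := abs_nonneg (tens (noise r p) b v)
    set t := |tens (noise r p) h v|
    set u := |tens (noise r p) b v|
    have : t ^ 2 * t ≤ t ^ 2 * (θ + u) := mul_le_mul_of_nonneg_left a3 (sq_nonneg t)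
    have : t ^ 2 * u ≤ t * u := mul_le_mul_of_nonneg_right (by nlinarith) a5
    nlinarith
  calc _ ≤ _ := exps_mono hp0 hpt
    _ = θ * exps p (fun v => tens (noise r p) h v ^ 2) +
        exps p (fun v => |tens (noise r p) h v| * |tens (noise r p) b v|) := by
        rw [exps_add, exps_const_mul]
    _ ≤ θ * H + θ * H := add_le_add (mul_le_mul_of_nonneg_left (hcontr h) hθ0.le) hcs
    _ = ξ * H := by rw [hθ]; ring

lemma mean_mem {p : α → ℝ} (hp0 : ∀ a, 0 ≤ p a) (hp1 : ∑ a, p a = 1) {F : α → ℝ}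
    (hF : ∀ a, F a ∈ Set.Icc (0:ℝ) 1) : ∑ a, p a * F a ∈ Set.Icc (0:ℝ) 1 := by
  constructor
  · exact Finset.sum_nonneg fun a _ => mul_nonneg (hp0 a) (hF a).1
  · rw [← hp1]
    exact Finset.sum_le_sum fun a _ => by nlinarith [hp0 a, (hF a).2]

lemma lap_abs_le {p : α → ℝ} (hp0 : ∀ a, 0 ≤ p a) (hp1 : ∑ a, p a = 1) {f : (Fin n → α) → ℝ}
    (hf : ∀ v, f v ∈ Set.Icc (0:ℝ) 1) (i : Fin n) (v : Fin n → α) : |lap p i f v| ≤ 1 := by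
  unfold lap
  have h1 := hf v
  have h2 := mean_mem hp0 hp1 (F := fun a => f (Function.update v i a)) (fun a => hf _)
  rw [abs_le]
  constructor <;> linarith [h1.1, h1.2, h2.1, h2.2]

lemma tens_mem {β : Type} {K : β → α → ℝ} (hK : ∀ b a, 0 ≤ K b a)
    (hK1 : ∀ b, ∑ a, K b a = 1) {f : (Fin n → α) → ℝ} (hf : ∀ v, f v ∈ Set.Icc (0:ℝ) 1)
    [Fintype β] (w : Fin n → β) : tens K f w ∈ Set.Icc (0:ℝ) 1 := by
  constructor
  · rw [← tens_const hK1 0 w]; exact tens_mono hK (fun v => (hf v).1) w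
  · rw [← tens_const hK1 1 w]; exact tens_mono hK (fun v => (hf v).2) w

lemma exps_sq_le_one {p : α → ℝ} (hp0 : ∀ a, 0 ≤ p a) (hp1 : ∑ a, p a = 1) {f : (Fin n → α) → ℝ}
    (hf : ∀ v, f v ∈ Set.Icc (0:ℝ) 1) : exps p (fun v => f v ^ 2) ≤ 1 := by
  rw [← exps_const (n := n) hp1 1]
  exact exps_mono hp0 fun v => by have := hf v; nlinarith [this.1, this.2]

lemma sum_third {p : α → ℝ} {l : ℝ} (hl : 0 < l) (hp : ∀ a, l ≤ p a) (hp1 : ∑ a, p a = 1) {r : ℝ}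
    (h0 : 0 ≤ r) (h1 : r < 1) {ξ : ℝ} (hξ : 0 < ξ) :
    ∃ τ : ℝ, 0 < τ ∧ ∀ (n : ℕ) (f : (Fin n → α) → ℝ), (∀ v, f v ∈ Set.Icc (0:ℝ) 1) →
      (∀ i, exps p (fun v => lap p i f v ^ 2) ≤ τ) →
      ∑ i, exps p (fun v => |lap p i (tens (noise (r * r) p) f) v| ^ 3) ≤ ξ := by
  have hp0 : ∀ a, 0 ≤ p a := fun a => hl.le.trans (hp a)
  have hr2 : 0 < 1 - r ^ 2 := by nlinarith
  obtain ⟨τ, hτ0, hτ⟩ := third hl hp hp1 h0 h1 (ξ := ξ * (1 - r ^ 2)) (by positivity)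
  refine ⟨τ, hτ0, fun n f hf hinf => ?_⟩
  have hTf : ∀ v, tens (noise r p) f v ∈ Set.Icc (0:ℝ) 1 :=
    tens_mem (noise_nonneg hp0 h0 h1.le) (noise_row hp1 r) hf
  have e : ∀ i, (fun v => |lap p i (tens (noise (r * r) p) f) v| ^ 3) =
      fun v => |tens (noise r p) (lap p i (tens (noise r p) f)) v| ^ 3 := by
    intro i; funext v
    rw [← lap_T hp1]
    congr 3
    funext v
    rw [tens_tens _ _ _ (noise_comp hp1 r r)]
  calc _ ≤ ∑ i, ξ * (1 - r ^ 2) * exps p (fun v => lap p i (tens (noise r p) f) v ^ 2) := by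
        refine Finset.sum_le_sum fun i _ => ?_
        rw [e]
        refine hτ n _ (lap_abs_le hp0 hp1 hTf i) ?_
        refine le_trans ?_ (hinf i)
        simp only [lap_T hp1]
        exact exps_tens_sq_le hp0 (noise_nonneg hp0 h0 h1.le) (noise_row hp1 r) (noise_stat hp1 r) _
    _ = ξ * (1 - r ^ 2) * ∑ i, exps p (fun v => lap p i (tens (noise r p) f) v ^ 2) := by
        rw [Finset.mul_sum]
    _ ≤ ξ * (1 - r ^ 2) * ((1 / (1 - r ^ 2)) * 1) := by
        refine mul_le_mul_of_nonneg_left ((energy hp0 hp1 h0 h1 f).trans ?_) (by positivity)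
        exact mul_le_mul_of_nonneg_left (exps_sq_le_one hp0 hp1 hf) (by positivity)
    _ = ξ := by field_simp

lemma smoothing {β : Type} [Fintype β] {K : β → α → ℝ} {p : α → ℝ} {q : β → ℝ} {ρ r : ℝ}
    (hp0 : ∀ a, 0 ≤ p a) (hp1 : ∑ a, p a = 1)
    (hq : ∀ b, 0 ≤ q b) (hq1 : ∑ b, q b = 1) (hK : ∀ b a, 0 ≤ K b a) (hK1 : ∀ b, ∑ a, K b a = 1)
    (hqK : ∀ a, ∑ b, q b * K b a = p a)
    (hU : ∀ u : α → ℝ, ∑ a, p a * u a = 0 →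
      ∑ b, q b * (∑ a, K b a * u a) ^ 2 ≤ ρ ^ 2 * ∑ a, p a * u a ^ 2)
    (hρ : ρ ^ 2 < 1) (h0 : 0 ≤ r) (h1 : r ≤ 1) (f : (Fin n → α) → ℝ) :
    exps q (fun w => tens K (fun v => f v - tens (noise r p) f v) w ^ 2) ≤
      (1 - r) / (1 - ρ ^ 2) * exps p (fun v => f v ^ 2) := by
  set κ := (1 - r) / (1 - ρ ^ 2) with hκ
  have hκ0 : 0 ≤ κ := div_nonneg (by linarith) (by linarith)
  have hκ1 : κ * (1 - ρ ^ 2) = 1 - r := by rw [hκ]; field_simp [show (1 - ρ ^ 2) ≠ 0 by linarith]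
  have hκ2 : ρ ^ 2 * (r * κ + (1 - r)) ≤ κ := by
    have : ρ ^ 2 * (1 - r) ≤ 1 - r := by nlinarith
    have : ρ ^ 2 * (r * κ) ≤ ρ ^ 2 * κ := by
      apply mul_le_mul_of_nonneg_left _ (sq_nonneg ρ); nlinarith
    nlinarith
  induction n with
  | zero =>
    simp only [exps_zero, tens_zero, sub_self]
    norm_num
    positivity
  | succ n ih =>
    rw [exps_sq_decomp1 hp1 f]
    set m : (Fin n → α) → ℝ := fun v => ∑ a, p a * f (Fin.cons a v) with hm
    set d : α → (Fin n → α) → ℝ := fun x v => f (Fin.cons x v) - m v with hd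
    set A : (Fin n → β) → ℝ := tens K (fun v => m v - tens (noise r p) m v) with hA
    set B : α → (Fin n → β) → ℝ := fun a => tens K (fun v => d a v - r * tens (noise r p) (d a) v) with hB
    have hT : ∀ x v, tens (noise r p) f (Fin.cons x v) =
        tens (noise r p) m v + r * tens (noise r p) (d x) v := by
      intro x v
      rw [T_cons, ← tens_const_mul, ← tens_add]
      congr 1; funext v; simp only [hd, hm]; ring
    have hd0 : ∀ v, ∑ x, p x * d x v = 0 := by
      intro v
      simp only [hd, mul_sub, Finset.sum_sub_distrib]
      rw [← Finset.sum_mul, hp1, hm]; simp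
    have hB0 : ∀ w, ∑ a, p a * B a w = 0 := by
      intro w
      simp only [hB, ← tens_const_mul, ← tens_sum]
      have : (fun v => ∑ a, p a * (d a v - tens (noise r p) (fun v => r * d a v) v)) =
          fun _ : Fin n → α => (0:ℝ) := by
        funext v
        simp only [mul_sub, Finset.sum_sub_distrib, hd0]
        simp only [← tens_const_mul, ← tens_sum]
        have : (fun v => ∑ i, p i * (r * d i v)) = fun _ : Fin n → α => (0:ℝ) := by
          funext v
          simp only [mul_left_comm (p _) r, ← Finset.mul_sum, hd0, mul_zero]
        rw [this, tens_const (noise_row hp1 r)]; ring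
      rw [this, tens_const hK1]
    have hcons : ∀ b w, tens K (fun v => f v - tens (noise r p) f v) (Fin.cons b w) =
        A w + ∑ a, K b a * B a w := by
      intro b w
      rw [tens_cons]
      have : ∀ a, tens K (fun v => f (Fin.cons a v) - tens (noise r p) f (Fin.cons a v)) w =
          A w + B a w := by
        intro a
        simp only [hA, hB, ← tens_add]
        congr 1; funext v
        rw [hT]; simp only [hd]; ring
      simp only [this, mul_add, Finset.sum_add_distrib]
      rw [← Finset.sum_mul, hK1, one_mul]
    have hpt : ∀ w, ∑ b, q b * tens K (fun v => f v - tens (noise r p) f v) (Fin.cons b w) ^ 2 ≤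
        A w ^ 2 + ρ ^ 2 * ∑ a, p a * B a w ^ 2 := by
      intro w
      simp only [hcons]
      have hx : ∑ b, q b * ∑ a, K b a * B a w = 0 := by
        simp only [Finset.mul_sum]
        rw [Finset.sum_comm, ← hB0 w]
        refine Finset.sum_congr rfl fun a _ => ?_
        rw [← hqK a, Finset.sum_mul]
        exact Finset.sum_congr rfl fun b _ => by ring
      have e : ∀ b, q b * (A w + ∑ a, K b a * B a w) ^ 2 =
        q b * A w ^ 2 + 2 * A w * (q b * ∑ a, K b a * B a w) + q b * (∑ a, K b a * B a w) ^ 2 :=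
        fun b => by ring
      simp only [e, Finset.sum_add_distrib]
      rw [← Finset.mul_sum, hx, ← Finset.sum_mul, hq1]
      have := hU (fun a => B a w) (hB0 w)
      linarith
    have hBE : ∀ a, exps q (fun w => B a w ^ 2) ≤ (r * κ + (1 - r)) * exps p (fun v => d a v ^ 2) := by
      intro a
      have e : ∀ w, B a w ^ 2 ≤ r * tens K (fun v => d a v - tens (noise r p) (d a) v) w ^ 2
          + (1 - r) * tens K (d a) w ^ 2 := by
        intro w
        have : B a w = r * tens K (fun v => d a v - tens (noise r p) (d a) v) w
          + (1 - r) * tens K (d a) w := by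
          rw [← tens_const_mul, ← tens_const_mul, ← tens_add]
          simp only [hB]
          congr 1; funext v; ring
        rw [this]
        set s := tens K (fun v => d a v - tens (noise r p) (d a) v) w
        set t := tens K (d a) w
        nlinarith [mul_nonneg (mul_nonneg h0 (sub_nonneg.2 h1)) (sq_nonneg (s - t))]
      refine (exps_mono hq e).trans ?_
      rw [exps_add, exps_const_mul, exps_const_mul]
      have i1 := mul_le_mul_of_nonneg_left (ih (d a)) h0
      have i2 := mul_le_mul_of_nonneg_left (exps_tens_sq_le hq hK hK1 hqK (d a)) (sub_nonneg.2 h1)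
      linarith
    calc _ = exps q (fun w => ∑ b, q b *
              tens K (fun v => f v - tens (noise r p) f v) (Fin.cons b w) ^ 2) := by
          rw [exps_succ, exps_sum]; simp only [exps_const_mul]
      _ ≤ _ := exps_mono hq hpt
      _ = exps q (fun w => A w ^ 2) + ρ ^ 2 * ∑ a, p a * exps q (fun w => B a w ^ 2) := by
          rw [exps_add, exps_const_mul, exps_sum]; simp only [exps_const_mul]
      _ ≤ κ * exps p (fun v => m v ^ 2) +
          ρ ^ 2 * ∑ a, p a * ((r * κ + (1 - r)) * exps p (fun v => d a v ^ 2)) := by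
          gcongr with a _
          · exact ih m
          · exact hp0 a
          · exact hBE a
      _ = κ * exps p (fun v => m v ^ 2) +
          ρ ^ 2 * (r * κ + (1 - r)) * ∑ a, p a * exps p (fun v => d a v ^ 2) := by
          congr 1
          rw [mul_assoc, Finset.mul_sum]
          congr 1
          simp only [Finset.mul_sum]
          exact Finset.sum_congr rfl fun a _ => by ring
      _ ≤ _ := by
          rw [mul_add κ]
          exact add_le_add le_rfl (mul_le_mul_of_nonneg_right hκ2
            (Finset.sum_nonneg fun a _ => mul_nonneg (hp0 a) (exps_nonneg hp0 fun v => sq_nonneg _)))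

end Third

section OneStep

theorem bern2 (y : ℝ) (hy : -1 ≤ y) (k : ℕ) : 1 + (k + 1 : ℝ) * y + k * y ^ 2 ≤ (1 + y) ^ (k + 1) := by
  induction k with
  | zero => simp
  | succ k ih =>
    have h : 0 ≤ 1 + y := by linarith
    have := mul_le_mul_of_nonneg_right ih h
    rw [pow_succ]
    refine le_trans ?_ this
    push_cast
    have hk : (0:ℝ) ≤ k := Nat.cast_nonneg k
    nlinarith [mul_nonneg (mul_nonneg hk h) (sq_nonneg y)]

set_option maxHeartbeats 1600000 in
theorem core_pos {γ : Type} [Fintype γ] (Q : γ → ℝ) (hQ0 : ∀ c, 0 ≤ Q c) (hQ1 : ∑ c, Q c = 1)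
    {q0 ρ θ : ℝ} {m k : ℕ} (hq0 : 0 < q0) (hq : ∀ c, Q c = 0 ∨ q0 ≤ Q c)
    (hρ0 : 0 < ρ) (hρ : ρ < 1) (hm1 : 1 ≤ m) (hm : 4 ≤ m * (1 - ρ)) (hk1 : 1 ≤ k)
    (hk : 4 ≤ k * q0 ^ 2) (hq01 : q0 ≤ 1)
    (hθ0 : 0 < θ) (hθ : θ * (12 * m) ≤ (1 - ρ) * q0)
    (u v : γ → ℝ) (hu : ∀ c, |u c| ≤ θ) (hv : ∀ c, -1 ≤ v c)
    (hEu : ∑ c, Q c * u c = 0) (hEv : ∑ c, Q c * v c = 0)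
    (hE : -ρ * (∑ c, Q c * u c ^ 2 + ∑ c, Q c * v c ^ 2) ≤ 2 * ∑ c, Q c * (u c * v c)) :
    1 ≤ ∑ c, Q c * ((1 + u c) * (1 + v c)) ^ (m * (k + 1)) := by
  have hm' : (1:ℝ) ≤ m := by exact_mod_cast hm1
  have hk' : (1:ℝ) ≤ k := by exact_mod_cast hk1
  have hm0 : (0:ℝ) < m := by linarith
  have hθm : θ * (12 * m) ≤ q0 := hθ.trans (by nlinarith)
  have hθ1 : θ ≤ 1 / 12 := by nlinarith
  have hnn : ∀ c, 0 ≤ (1 + u c) * (1 + v c) := fun c =>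
    mul_nonneg (by linarith [(abs_le.1 (hu c)).1]) (by linarith [hv c])
  by_cases hcase : ∃ c, Q c ≠ 0 ∧ v c < -(1 / (2 * m))
  · obtain ⟨c0, hc0, hvc0⟩ := hcase
    have hc0' : q0 ≤ Q c0 := (hq c0).resolve_left hc0
    obtain ⟨c1, hc1, hvc1⟩ : ∃ c, Q c ≠ 0 ∧ q0 / (2 * m) ≤ v c := by
      by_contra hcon
      push Not at hcon
      have h1 : ∀ c ∈ Finset.univ, 0 ≤ Q c * (q0 / (2 * m) - v c) := by
        intro c _
        by_cases hc : Q c = 0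
        · simp [hc]
        · exact mul_nonneg (hQ0 c) (by linarith [hcon c hc])
      have h2 := Finset.single_le_sum h1 (Finset.mem_univ c0)
      have h3 : ∑ c, Q c * (q0 / (2 * m) - v c) = q0 / (2 * m) := by
        simp only [mul_sub, Finset.sum_sub_distrib, hEv, ← Finset.sum_mul, hQ1]; ring
      rw [h3] at h2
      have h4 : 0 < q0 / (2 * m) := by positivity
      have h5 : (0:ℝ) < 1 / (2 * m) := by positivity
      have h6 : q0 / (2 * m) = q0 * (1 / (2 * m)) := by ring
      have h7 : q0 * (q0 / (2 * m) - v c0) ≤ Q c0 * (q0 / (2 * m) - v c0) :=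
        mul_le_mul_of_nonneg_right hc0' (by linarith)
      have h8 : q0 * (1 / (2 * m)) < q0 * (q0 / (2 * m) - v c0) :=
        mul_lt_mul_of_pos_left (by linarith) hq0
      linarith
    have hc1' : q0 ≤ Q c1 := (hq c1).resolve_left hc1
    set s : ℝ := q0 / (4 * m) with hs
    have hs0 : 0 < s := by positivity
    have hs2 : q0 / (2 * m) = 2 * s := by rw [hs]; field_simp; ring
    have hsm : s * m = q0 / 4 := by rw [hs]; field_simp
    have hs1 : s ≤ 1 / 4 := by nlinarith
    have hθs : 3 * θ ≤ s := by
      rw [hs, le_div_iff₀ (by positivity)]; linarith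
    have hb : 1 + s ≤ (1 + u c1) * (1 + v c1) := by
      have := (abs_le.1 (hu c1)).1
      calc 1 + s ≤ (1 - θ) * (1 + 2 * s) := by nlinarith
        _ ≤ _ := mul_le_mul (by linarith) (by linarith) (by linarith) (by linarith)
    have hpow : 1 + k * (q0 / 4) ≤ ((1 + u c1) * (1 + v c1)) ^ (m * (k + 1)) := by
      have e1 : 1 + q0 / 4 ≤ ((1 + u c1) * (1 + v c1)) ^ m := by
        have := one_add_mul_le_pow (a := s) (by linarith) m
        refine le_trans (by linarith) (this.trans (pow_le_pow_left₀ (by linarith) hb m))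
      rw [pow_mul]
      have := one_add_mul_le_pow (a := q0 / 4) (by linarith) (k + 1)
      refine le_trans ?_ (this.trans (pow_le_pow_left₀ (by linarith) e1 _))
      push_cast; nlinarith
    have := Finset.single_le_sum (f := fun c => Q c * ((1 + u c) * (1 + v c)) ^ (m * (k + 1)))
      (fun c _ => mul_nonneg (hQ0 c) (pow_nonneg (hnn c) _)) (Finset.mem_univ c1)
    refine le_trans ?_ this
    calc (1:ℝ) ≤ q0 * (1 + k * (q0 / 4)) := by nlinarith
      _ ≤ _ := mul_le_mul hc1' hpow (by positivity) (hQ0 _)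
  · push Not at hcase
    set t : γ → ℝ := fun c => (1 + u c) * (1 + v c) - 1 with ht
    have hpt : ∀ c, Q c * (1 + (k + 1) * (m * t c) + k * (m * t c) ^ 2) ≤
        Q c * ((1 + u c) * (1 + v c)) ^ (m * (k + 1)) := by
      intro c
      by_cases hc : Q c = 0
      · simp [hc]
      refine mul_le_mul_of_nonneg_left ?_ (hQ0 c)
      have hvc := hcase c hc
      have huc := (abs_le.1 (hu c)).1
      have hz : (0:ℝ) < 1 / (2 * m) := by positivity
      have hzm : 1 / (2 * (m:ℝ)) * m = 1 / 2 := by field_simp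
      have hz1 : 1 / (2 * (m:ℝ)) ≤ 1 / 2 := by nlinarith
      have h1 : (1 - θ) * (1 - 1 / (2 * m)) ≤ (1 + u c) * (1 + v c) :=
        mul_le_mul (by linarith) (by linarith) (by linarith) (by linarith)
      have h2 : -(1/12:ℝ) ≤ - (θ * m) := by linarith
      have hmt : -1 ≤ m * t c := by
        have : -(θ + 1 / (2 * m)) ≤ t c := by
          simp only [ht]; nlinarith [mul_pos hθ0 hz]
        have := mul_le_mul_of_nonneg_left this hm0.le
        nlinarith
      have h3 : 1 + m * t c ≤ ((1 + u c) * (1 + v c)) ^ m := by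
        have := one_add_mul_le_pow (a := t c) (by have := hnn c; simp only [ht]; linarith) m
        simpa [ht] using this
      rw [pow_mul]
      exact (bern2 _ hmt k).trans (pow_le_pow_left₀ (by linarith) h3 _)
    refine le_trans ?_ (Finset.sum_le_sum fun c _ => hpt c)
    set A := ∑ c, Q c * u c ^ 2
    set B := ∑ c, Q c * v c ^ 2
    set D := ∑ c, Q c * (u c * v c)
    have hA : 0 ≤ A := Finset.sum_nonneg fun c _ => mul_nonneg (hQ0 c) (sq_nonneg _)
    have hB : 0 ≤ B := Finset.sum_nonneg fun c _ => mul_nonneg (hQ0 c) (sq_nonneg _)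
    have e1 : ∑ c, Q c * t c = D := by
      have : ∀ c, Q c * t c = Q c * u c + Q c * v c + Q c * (u c * v c) := fun c => by
        simp only [ht]; ring
      simp only [this, Finset.sum_add_distrib, hEu, hEv]; simp [D]
    have e2 : (1 - ρ) / 4 * (A + B) ≤ ∑ c, Q c * t c ^ 2 := by
      have h1 : ∑ c, Q c * ((u c ^ 2 + v c ^ 2 + 2 * (u c * v c)) / 2 - θ ^ 2 * v c ^ 2) ≤
          ∑ c, Q c * t c ^ 2 := by
        refine Finset.sum_le_sum fun c _ => mul_le_mul_of_nonneg_left ?_ (hQ0 c)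
        have h2 : (u c * v c) ^ 2 ≤ θ ^ 2 * v c ^ 2 := by
          rw [mul_pow]
          exact mul_le_mul_of_nonneg_right (sq_le_sq' (by linarith [(abs_le.1 (hu c)).1]) (abs_le.1 (hu c)).2) (sq_nonneg _)
        have h3 : t c = (u c + v c) + u c * v c := by simp only [ht]; ring
        have h4 : ∀ s w : ℝ, s ^ 2 / 2 - w ^ 2 ≤ (s + w) ^ 2 := fun s w => by
          linarith [sq_nonneg (s + 2 * w)]
        rw [h3]
        refine le_trans ?_ (h4 _ _)
        linarith [h2]
      have h4 : ∑ c, Q c * ((u c ^ 2 + v c ^ 2 + 2 * (u c * v c)) / 2 - θ ^ 2 * v c ^ 2) =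
          (A + B + 2 * D) / 2 - θ ^ 2 * B := by
        simp only [A, B, D, Finset.mul_sum, ← Finset.sum_add_distrib, ← Finset.sum_sub_distrib, Finset.sum_div]
        exact Finset.sum_congr rfl fun c _ => by ring
      rw [h4] at h1
      have hθ2 : θ ^ 2 ≤ (1 - ρ) / 4 := by
        have : θ * 12 ≤ (1 - ρ) := by nlinarith
        nlinarith
      nlinarith [mul_le_mul_of_nonneg_right hθ2 hB, mul_nonneg (by linarith : 0 ≤ (1 - ρ)/4) hA]
    have e3 : ∑ c, Q c * (1 + (k + 1) * (m * t c) + k * (m * t c) ^ 2) =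
        ∑ c, Q c + (k + 1) * m * D + k * m ^ 2 * ∑ c, Q c * t c ^ 2 := by
      rw [← e1]
      simp only [Finset.mul_sum, ← Finset.sum_add_distrib]
      exact Finset.sum_congr rfl fun c _ => by ring
    rw [e3, hQ1]
    have h5 : k * m ^ 2 * ((1 - ρ) / 4 * (A + B)) ≤ k * m ^ 2 * ∑ c, Q c * t c ^ 2 :=
      mul_le_mul_of_nonneg_left e2 (by positivity)
    have h6 : k * m * (A + B) ≤ k * m ^ 2 * ((1 - ρ) / 4 * (A + B)) := by
      have : (k * m * (A + B)) * 4 ≤ (k * m * (A + B)) * (m * (1 - ρ)) :=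
        mul_le_mul_of_nonneg_left hm (by positivity)
      nlinarith
    have h7 : (k + 1) * m * (-ρ * (A + B)) ≤ (k + 1) * m * (2 * D) :=
      mul_le_mul_of_nonneg_left hE (by positivity)
    have h8 : (k + 1) * m * (ρ * (A + B)) ≤ 2 * (k * m * (A + B)) := by
      have : (k + 1) * ρ ≤ 2 * k := by nlinarith
      have := mul_le_mul_of_nonneg_right this (by positivity : 0 ≤ m * (A + B))
      nlinarith
    nlinarith

end OneStep

section Tensor

/-- A joint law with marginals and correlation bound. -/
structure Corr {α β : Type} [Fintype α] [Fintype β] (Q : α × β → ℝ) (p : α → ℝ) (q : β → ℝ)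
    (ρ : ℝ) : Prop where
  nn : ∀ c, 0 ≤ Q c
  mp : ∀ a, ∑ b, Q (a, b) = p a
  mq : ∀ b, ∑ a, Q (a, b) = q b
  p1 : ∑ a, p a = 1
  ρ0 : 0 < ρ
  ρ1 : ρ < 1
  corr : ∀ (u : α → ℝ) (v : β → ℝ), ∑ a, p a * u a = 0 → ∑ b, q b * v b = 0 →
    2 * ∑ c : α × β, Q c * (u c.1 * v c.2) ≤ ρ * (∑ a, p a * u a ^ 2 + ∑ b, q b * v b ^ 2)

variable {α β : Type} [Fintype α] [Fintype β] {Q : α × β → ℝ} {p : α → ℝ} {q : β → ℝ} {ρ : ℝ}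

lemma Corr.fst (h : Corr Q p q ρ) (φ : α → ℝ) : ∑ c : α × β, Q c * φ c.1 = ∑ a, p a * φ a := by
  rw [Fintype.sum_prod_type]
  exact Finset.sum_congr rfl fun a _ => by rw [← h.mp a, Finset.sum_mul]

lemma Corr.snd (h : Corr Q p q ρ) (φ : β → ℝ) : ∑ c : α × β, Q c * φ c.2 = ∑ b, q b * φ b := by
  rw [Fintype.sum_prod_type_right]
  exact Finset.sum_congr rfl fun b _ => by rw [← h.mq b, Finset.sum_mul]

lemma Corr.q1 (h : Corr Q p q ρ) : ∑ b, q b = 1 := by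
  have h1 := h.fst (fun _ => 1)
  have h2 := h.snd (fun _ => 1)
  simp only [mul_one] at h1 h2
  rw [← h2, h1, h.p1]

lemma Corr.Q1 (h : Corr Q p q ρ) : ∑ c, Q c = 1 := by
  have h1 := h.fst (fun _ => 1)
  simp only [mul_one] at h1
  rw [h1, h.p1]

lemma Corr.p0 (h : Corr Q p q ρ) (a : α) : 0 ≤ p a := by
  rw [← h.mp]; exact Finset.sum_nonneg fun b _ => h.nn _

lemma Corr.q0 (h : Corr Q p q ρ) (b : β) : 0 ≤ q b := by
  rw [← h.mq]; exact Finset.sum_nonneg fun b _ => h.nn _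

lemma exists_min_pos {γ : Type} [Fintype γ] (Q : γ → ℝ) (hQ : ∀ c, 0 ≤ Q c) :
    ∃ q0 : ℝ, 0 < q0 ∧ q0 ≤ 1 ∧ ∀ c, Q c = 0 ∨ q0 ≤ Q c := by
  classical
  by_cases hne : (Finset.univ.filter fun c => 0 < Q c).Nonempty
  · obtain ⟨c0, hc0, hmin⟩ := Finset.exists_min_image _ Q hne
    have : 0 < Q c0 := (Finset.mem_filter.1 hc0).2
    refine ⟨min (Q c0) 1, lt_min this one_pos, min_le_right _ _, fun c => ?_⟩
    rcases (hQ c).eq_or_lt with h | h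
    · exact Or.inl h.symm
    · exact Or.inr ((min_le_left _ _).trans (hmin c (by simp [h])))
  · refine ⟨1, one_pos, le_rfl, fun c => Or.inl ?_⟩
    rcases (hQ c).eq_or_lt with h | h
    · exact h.symm
    · exact absurd ⟨c, by simp [h]⟩ hne

lemma one_step (h : Corr Q p q ρ) {l : ℝ} (hl : 0 < l) (hp : ∀ a, l ≤ p a) :
    ∃ (c : ℕ) (C : ℝ), 3 ≤ c ∧ 0 ≤ C ∧ ∀ (f : α → ℝ) (g : β → ℝ),
      (∀ a, f a ∈ Set.Icc (0:ℝ) 1) → (∀ b, g b ∈ Set.Icc (0:ℝ) 1) →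
      ((∑ a, p a * f a) * ∑ b, q b * g b) ^ c - C * ∑ a, p a * |f a - ∑ x, p x * f x| ^ 3 ≤
        ∑ s : α × β, Q s * (f s.1 * g s.2) ^ c := by
  obtain ⟨q0, hq0, hq01, hqmin⟩ := exists_min_pos Q h.nn
  have hρ' : 0 < 1 - ρ := by linarith [h.ρ1]
  obtain ⟨m, hm⟩ := exists_nat_ge (4 / (1 - ρ))
  rw [div_le_iff₀ hρ'] at hm
  obtain ⟨k, hk⟩ := exists_nat_ge (4 / q0 ^ 2)
  rw [div_le_iff₀ (by positivity)] at hk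
  have hm4 : (4:ℝ) ≤ m := by
    refine hm.trans ?_
    nlinarith [h.ρ0, Nat.cast_nonneg (α := ℝ) m]
  have hm4' : 4 ≤ m := by exact_mod_cast hm4
  have hk1 : 1 ≤ k := by
    rcases Nat.eq_zero_or_pos k with h0 | h0
    · subst h0; norm_num at hk
    · exact h0
  set θ : ℝ := (1 - ρ) * q0 / (12 * m) with hθ
  have hθ0 : 0 < θ := by positivity
  have hc3 : 3 ≤ m * (k + 1) := by nlinarith
  refine ⟨m * (k + 1), 1 / (l * θ ^ 3), hc3, by positivity, fun f g hf hg => ?_⟩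
  set a := ∑ x, p x * f x with ha
  set b := ∑ x, q x * g x with hb
  have ham : a ∈ Set.Icc (0:ℝ) 1 := mean_mem h.p0 h.p1 hf
  have hbm : b ∈ Set.Icc (0:ℝ) 1 := mean_mem h.q0 h.q1 hg
  have hfg : ∀ s : α × β, 0 ≤ f s.1 * g s.2 := fun s => mul_nonneg (hf _).1 (hg _).1
  have hR0 : 0 ≤ ∑ s : α × β, Q s * (f s.1 * g s.2) ^ (m * (k + 1)) :=
    Finset.sum_nonneg fun s _ => mul_nonneg (h.nn s) (pow_nonneg (hfg s) _)
  have hS0 : 0 ≤ ∑ x, p x * |f x - a| ^ 3 :=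
    Finset.sum_nonneg fun s _ => mul_nonneg (h.p0 s) (by positivity)
  have hab0 : 0 ≤ a * b := mul_nonneg ham.1 hbm.1
  by_cases hcase : ∃ x, θ * a < |f x - a|
  · obtain ⟨x, hx⟩ := hcase
    have h1 : p x * |f x - a| ^ 3 ≤ ∑ x, p x * |f x - a| ^ 3 :=
      Finset.single_le_sum (f := fun x => p x * |f x - a| ^ 3)
        (fun s _ => mul_nonneg (h.p0 s) (by positivity)) (Finset.mem_univ x)
    have h2 : l * (θ * a) ^ 3 ≤ p x * |f x - a| ^ 3 :=
      mul_le_mul (hp x) (pow_le_pow_left₀ (mul_nonneg hθ0.le ham.1) hx.le 3)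
        (pow_nonneg (mul_nonneg hθ0.le ham.1) 3) (h.p0 x)
    have h3 : a ^ 3 ≤ 1 / (l * θ ^ 3) * ∑ x, p x * |f x - a| ^ 3 := by
      rw [div_mul_eq_mul_div, one_mul, le_div_iff₀ (by positivity)]
      calc a ^ 3 * (l * θ ^ 3) = l * (θ * a) ^ 3 := by ring
        _ ≤ _ := h2.trans h1
    have h4 : (a * b) ^ (m * (k + 1)) ≤ a ^ 3 := by
      calc (a * b) ^ (m * (k + 1)) ≤ a ^ (m * (k + 1)) :=
            pow_le_pow_left₀ hab0 (mul_le_of_le_one_right ham.1 hbm.2) _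
        _ ≤ a ^ 3 := pow_le_pow_of_le_one ham.1 ham.2 hc3
    linarith
  · push Not at hcase
    rcases ham.1.eq_or_lt with ha0 | ha0
    · rw [← ha0, zero_mul, zero_pow (by omega)]
      have : 0 ≤ 1 / (l * θ ^ 3) * ∑ x, p x * |f x - a| ^ 3 := mul_nonneg (by positivity) hS0
      rw [← ha0] at this
      linarith
    rcases hbm.1.eq_or_lt with hb0 | hb0
    · rw [← hb0, mul_zero, zero_pow (by omega)]
      have : 0 ≤ 1 / (l * θ ^ 3) * ∑ x, p x * |f x - a| ^ 3 := mul_nonneg (by positivity) hS0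
      linarith
    have hEu : ∑ x, p x * ((f x - a) / a) = 0 := by
      have : ∀ x, p x * ((f x - a) / a) = (p x * f x) / a - p x := fun x => by field_simp
      simp only [this, Finset.sum_sub_distrib, h.p1, ← Finset.sum_div, ← ha]
      rw [div_self ha0.ne', sub_self]
    have hEv : ∑ x, q x * ((g x - b) / b) = 0 := by
      have : ∀ x, q x * ((g x - b) / b) = (q x * g x) / b - q x := fun x => by field_simp
      simp only [this, Finset.sum_sub_distrib, h.q1, ← Finset.sum_div, ← hb]
      rw [div_self hb0.ne', sub_self]
    have key := core_pos Q h.nn h.Q1 hq0 hqmin h.ρ0 h.ρ1 (m := m) (k := k) (θ := θ) (by omega) hm hk1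
      hk hq01 hθ0 (by rw [hθ]; field_simp; exact le_rfl)
      (fun s => (f s.1 - a) / a) (fun s => (g s.2 - b) / b)
      (fun s => by
        rw [abs_div, abs_of_pos ha0, div_le_iff₀ ha0]; exact hcase _)
      (fun s => by
        rw [le_div_iff₀ hb0]; linarith [(hg s.2).1])
      (by rw [h.fst (fun x => (f x - a) / a)]; exact hEu)
      (by rw [h.snd (fun x => (g x - b) / b)]; exact hEv)
      (by
        rw [h.fst (fun x => ((f x - a) / a) ^ 2), h.snd (fun x => ((g x - b) / b) ^ 2)]
        have := h.corr (fun x => (f x - a) / a) (fun x => -((g x - b) / b)) hEu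
          (by simp only [mul_neg, Finset.sum_neg_distrib, hEv, neg_zero])
        simp only [mul_neg, Finset.sum_neg_distrib, neg_sq] at this
        linarith)
    have hconv : ∀ s : α × β, Q s * (f s.1 * g s.2) ^ (m * (k + 1)) = (a * b) ^ (m * (k + 1)) *
        (Q s * ((1 + (f s.1 - a) / a) * (1 + (g s.2 - b) / b)) ^ (m * (k + 1))) := by
      intro s
      have : f s.1 * g s.2 = (a * b) * ((1 + (f s.1 - a) / a) * (1 + (g s.2 - b) / b)) := by
        field_simp; ring
      rw [this, mul_pow (a * b)]; ring
    simp only [hconv, ← Finset.mul_sum]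
    have h9 := mul_le_mul_of_nonneg_left key (pow_nonneg hab0 (m * (k + 1)))
    have : 0 ≤ 1 / (l * θ ^ 3) * ∑ x, p x * |f x - a| ^ 3 := mul_nonneg (by positivity) hS0
    linarith

lemma exps_mem {n : ℕ} {p : α → ℝ} (hp0 : ∀ a, 0 ≤ p a) (hp1 : ∑ a, p a = 1) {f : (Fin n → α) → ℝ}
    (hf : ∀ v, f v ∈ Set.Icc (0:ℝ) 1) : exps p f ∈ Set.Icc (0:ℝ) 1 := by
  constructor
  · exact exps_nonneg hp0 fun v => (hf v).1
  · rw [← exps_const (n := n) hp1 1]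
    exact exps_mono hp0 fun v => (hf v).2

lemma exps_jensen3 {n : ℕ} {p : α → ℝ} (hp0 : ∀ a, 0 ≤ p a) (hp1 : ∑ a, p a = 1)
    (f : (Fin n → α) → ℝ) : |exps p f| ^ 3 ≤ exps p (fun v => |f v| ^ 3) := by
  have hw : ∀ v ∈ (Finset.univ : Finset (Fin n → α)), 0 ≤ ∏ i, p (v i) :=
    fun v _ => Finset.prod_nonneg fun i _ => hp0 _
  have hw1 : ∑ v : Fin n → α, ∏ i, p (v i) = 1 := by
    have := exps_const (n := n) hp1 1
    simpa [exps] using this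
  have := Real.pow_arith_mean_le_arith_mean_pow Finset.univ (fun v : Fin n → α => ∏ i, p (v i))
    (fun v => |f v|) hw hw1 (fun v _ => abs_nonneg _) 3
  refine le_trans (pow_le_pow_left₀ (abs_nonneg _) ?_ 3) this
  unfold exps
  refine (Finset.abs_sum_le_sum_abs _ _).trans (Finset.sum_le_sum fun v hv => ?_)
  rw [abs_mul, abs_of_nonneg (hw v hv)]

lemma tensor_ineq (h : Corr Q p q ρ) {c : ℕ} {C : ℝ} (hc : 3 ≤ c) (hC : 0 ≤ C)
    (hone : ∀ (f : α → ℝ) (g : β → ℝ),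
      (∀ a, f a ∈ Set.Icc (0:ℝ) 1) → (∀ b, g b ∈ Set.Icc (0:ℝ) 1) →
      ((∑ a, p a * f a) * ∑ b, q b * g b) ^ c - C * ∑ a, p a * |f a - ∑ x, p x * f x| ^ 3 ≤
        ∑ s : α × β, Q s * (f s.1 * g s.2) ^ c)
    {n : ℕ} (F : (Fin n → α) → ℝ) (g : (Fin n → β) → ℝ)
    (hF : ∀ v, F v ∈ Set.Icc (0:ℝ) 1) (hg : ∀ v, g v ∈ Set.Icc (0:ℝ) 1) :
    (exps p F * exps q g) ^ c - C * ∑ i, exps p (fun v => |lap p i F v| ^ 3) ≤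
      exps Q (fun s => F (fun i => (s i).1) * g (fun i => (s i).2)) := by
  induction n with
  | zero =>
    simp only [exps_zero, Finset.univ_eq_empty, Finset.sum_empty, mul_zero, sub_zero]
    have e1 : (fun i : Fin 0 => ((default : Fin 0 → α × β) i).1) = default := Subsingleton.elim _ _
    have e2 : (fun i : Fin 0 => ((default : Fin 0 → α × β) i).2) = default := Subsingleton.elim _ _
    rw [e1, e2]
    exact pow_le_of_le_one (mul_nonneg (hF _).1 (hg _).1)
      (mul_le_one₀ (hF _).2 (hg _).1 (hg _).2) (by omega)
  | succ n ih =>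
    set f1 : α → ℝ := fun a => exps p (fun v => F (Fin.cons a v)) with hf1
    set g1 : β → ℝ := fun b => exps q (fun v => g (Fin.cons b v)) with hg1
    set L : α → ℝ := fun a => ∑ i, exps p (fun v => |lap p i (fun v => F (Fin.cons a v)) v| ^ 3) with hL
    have h1 := hone f1 g1 (fun a => exps_mem h.p0 h.p1 fun v => hF _)
      (fun b => exps_mem h.q0 h.q1 fun v => hg _)
    have hcons1 : ∀ (s : α × β) (w : Fin n → α × β),
        (fun i => ((Fin.cons s w : Fin (n+1) → α × β) i).1) = (Fin.cons s.1 (fun i => (w i).1) : Fin (n+1) → α) := by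
      intro s w; funext i; refine Fin.cases ?_ (fun i => ?_) i <;> simp
    have hcons2 : ∀ (s : α × β) (w : Fin n → α × β),
        (fun i => ((Fin.cons s w : Fin (n+1) → α × β) i).2) = (Fin.cons s.2 (fun i => (w i).2) : Fin (n+1) → β) := by
      intro s w; funext i; refine Fin.cases ?_ (fun i => ?_) i <;> simp
    rw [exps_succ Q, exps_succ p F, exps_succ q g]
    simp only [hcons1, hcons2]
    have h2 : ∑ s : α × β, Q s * ((f1 s.1 * g1 s.2) ^ c - C * L s.1) ≤ ∑ s : α × β, Q s *
        exps Q (fun w => F (Fin.cons s.1 fun i => (w i).1) * g (Fin.cons s.2 fun i => (w i).2)) :=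
      Finset.sum_le_sum fun s _ => mul_le_mul_of_nonneg_left
        (ih (fun v => F (Fin.cons s.1 v)) (fun v => g (Fin.cons s.2 v)) (fun _ => hF _) (fun _ => hg _))
        (h.nn s)
    refine le_trans ?_ h2
    have h3 : ∑ s : α × β, Q s * ((f1 s.1 * g1 s.2) ^ c - C * L s.1) =
        ∑ s : α × β, Q s * (f1 s.1 * g1 s.2) ^ c - C * ∑ a, p a * L a := by
      simp only [mul_sub, Finset.sum_sub_distrib]
      congr 1
      rw [h.fst (fun a => C * L a), Finset.mul_sum]
      exact Finset.sum_congr rfl fun a _ => by ring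
    rw [h3]
    have h4 : ∑ i : Fin (n+1), exps p (fun v => |lap p i F v| ^ 3) =
        ∑ a, p a * exps p (fun v => |F (Fin.cons a v) - ∑ b, p b * F (Fin.cons b v)| ^ 3)
          + ∑ a, p a * L a := by
      rw [Fin.sum_univ_succ]
      congr 1
      · rw [exps_succ]; simp only [lap_zero]
      · simp only [exps_succ, lap_succ, hL, Finset.mul_sum]
        exact Finset.sum_comm
    have h5 : ∑ a, p a * |f1 a - ∑ x, p x * f1 x| ^ 3 ≤
        ∑ a, p a * exps p (fun v => |F (Fin.cons a v) - ∑ b, p b * F (Fin.cons b v)| ^ 3) := by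
      refine Finset.sum_le_sum fun a _ => mul_le_mul_of_nonneg_left ?_ (h.p0 a)
      have : f1 a - ∑ x, p x * f1 x =
          exps p (fun v => F (Fin.cons a v) - ∑ b, p b * F (Fin.cons b v)) := by
        rw [exps_sub, exps_sum]; simp only [exps_const_mul, hf1]
      rw [this]
      exact exps_jensen3 h.p0 h.p1 _
    rw [h4, mul_add]
    have := mul_le_mul_of_nonneg_left h5 hC
    linarith

end Tensor

section TwoFun
variable {α β : Type} [Fintype α] [Fintype β] {Q : α × β → ℝ} {p : α → ℝ} {q : β → ℝ} {ρ : ℝ}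

open Classical in
/-- The conditional kernel. -/
noncomputable def ker (Q : α × β → ℝ) (p : α → ℝ) (q : β → ℝ) (b : β) (a : α) : ℝ :=
  if q b = 0 then p a else Q (a, b) / q b

lemma Corr.ker_nn (h : Corr Q p q ρ) (b : β) (a : α) : 0 ≤ ker Q p q b a := by
  unfold ker
  split_ifs
  · exact h.p0 a
  · exact div_nonneg (h.nn _) (h.q0 b)

lemma Corr.ker_row (h : Corr Q p q ρ) (b : β) : ∑ a, ker Q p q b a = 1 := by
  unfold ker
  split_ifs with hb
  · exact h.p1
  · rw [← Finset.sum_div, h.mq, div_self hb]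

lemma Corr.ker_joint (h : Corr Q p q ρ) (a : α) (b : β) : q b * ker Q p q b a = Q (a, b) := by
  unfold ker
  split_ifs with hb
  · rw [hb, zero_mul]
    have h1 := h.mq b
    rw [hb] at h1
    exact ((Finset.sum_eq_zero_iff_of_nonneg fun a _ => h.nn (a, b)).1 h1 a (Finset.mem_univ a)).symm
  · field_simp

lemma Corr.ker_stat (h : Corr Q p q ρ) (a : α) : ∑ b, q b * ker Q p q b a = p a := by
  simp only [h.ker_joint, h.mp]

lemma Corr.ker_contr (h : Corr Q p q ρ) (u : α → ℝ) (hu : ∑ a, p a * u a = 0) :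
    ∑ b, q b * (∑ a, ker Q p q b a * u a) ^ 2 ≤ ρ ^ 2 * ∑ a, p a * u a ^ 2 := by
  set w : β → ℝ := fun b => ∑ a, ker Q p q b a * u a with hw
  have hj : ∀ φ : β → ℝ, ∑ c : α × β, Q c * (u c.1 * φ c.2) = ∑ b, q b * (w b * φ b) := by
    intro φ
    rw [Fintype.sum_prod_type_right]
    refine Finset.sum_congr rfl fun b _ => ?_
    simp only [hw, Finset.sum_mul, Finset.mul_sum]
    refine Finset.sum_congr rfl fun a _ => ?_
    rw [← h.ker_joint a b]; ring
  have h0 : ∑ b, q b * w b = 0 := by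
    have := hj (fun _ => 1)
    simp only [mul_one] at this
    rw [← this, h.fst u, hu]
  have hρ := h.ρ0
  have h1 := h.corr u (fun b => w b / ρ) hu (by
    simp only [← mul_div_assoc, ← Finset.sum_div, h0, zero_div])
  rw [hj (fun b => w b / ρ)] at h1
  have e1 : ∑ b, q b * (w b * (w b / ρ)) = (∑ b, q b * w b ^ 2) / ρ := by
    rw [Finset.sum_div]; exact Finset.sum_congr rfl fun b _ => by ring
  have e2 : ∑ b, q b * (w b / ρ) ^ 2 = (∑ b, q b * w b ^ 2) / ρ ^ 2 := by
    rw [Finset.sum_div]; exact Finset.sum_congr rfl fun b _ => by ring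
  rw [e1, e2] at h1
  set W := ∑ b, q b * w b ^ 2
  set A := ∑ a, p a * u a ^ 2
  have h2 := mul_le_mul_of_nonneg_left h1 hρ.le
  have e3 : ρ * (2 * (W / ρ)) = 2 * W := by field_simp
  have e4 : ρ * (ρ * (A + W / ρ ^ 2)) = ρ ^ 2 * A + W := by field_simp
  rw [e3, e4] at h2
  linarith

lemma two_fun (h : Corr Q p q ρ) {l : ℝ} (hl : 0 < l) (hp : ∀ a, l ≤ p a) {μ ν : ℝ}
    (hμ : 0 < μ) (hν : 0 < ν) :
    ∃ τ δ : ℝ, 0 < τ ∧ 0 < δ ∧ ∀ (n : ℕ) (f : (Fin n → α) → ℝ) (g : (Fin n → β) → ℝ),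
      (∀ v, f v ∈ Set.Icc (0:ℝ) 1) → (∀ v, g v ∈ Set.Icc (0:ℝ) 1) →
      μ ≤ exps p f → ν ≤ exps q g → (∀ i, exps p (fun v => lap p i f v ^ 2) ≤ τ) →
      δ ≤ exps Q (fun s => f (fun i => (s i).1) * g (fun i => (s i).2)) := by
  obtain ⟨c, C, hc, hC, hone⟩ := one_step h hl hp
  set B := (μ * ν) ^ c with hB
  have hB0 : 0 < B := by positivity
  have hρ2 : ρ ^ 2 < 1 := by nlinarith [h.ρ0, h.ρ1]
  have hρ2' : 0 < 1 - ρ ^ 2 := by linarith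
  set s := min ((1 - ρ ^ 2) * (B / 4) ^ 2) 1 with hs
  have hs0 : 0 < s := lt_min (by positivity) one_pos
  have hs1 : s ≤ 1 := min_le_right _ _
  have hs2 : s ≤ (1 - ρ ^ 2) * (B / 4) ^ 2 := min_le_left _ _
  set r := 1 - s / 2 with hr
  have hr0 : 0 ≤ r := by linarith
  have hr1 : r < 1 := by linarith
  have hrr : 1 - r * r ≤ s := by rw [hr]; nlinarith [sq_nonneg s]
  obtain ⟨τ, hτ, hthird⟩ := sum_third hl hp h.p1 hr0 hr1 (ξ := B / (4 * (C + 1))) (by positivity)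
  refine ⟨τ, B / 2, hτ, by positivity, fun n f g hf hg hfμ hgν hinf => ?_⟩
  set T := tens (noise (r * r) p) f with hT
  have hrr0 : 0 ≤ r * r := by positivity
  have hrr1 : r * r ≤ 1 := by nlinarith
  have hTm : ∀ v, T v ∈ Set.Icc (0:ℝ) 1 :=
    fun v => tens_mem (noise_nonneg h.p0 hrr0 hrr1) (noise_row h.p1 _) hf v
  have hTe : exps p T = exps p f := exps_tens (noise_stat h.p1 _) f
  have h1 := tensor_ineq h hc hC hone T g hTm hg
  have h2 := hthird n f hf hinf
  have h3 : C * ∑ i, exps p (fun v => |lap p i T v| ^ 3) ≤ B / 4 := by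
    calc C * ∑ i, exps p (fun v => |lap p i T v| ^ 3) ≤ C * (B / (4 * (C + 1))) :=
          mul_le_mul_of_nonneg_left h2 hC
      _ = B / 4 * (C / (C + 1)) := by field_simp
      _ ≤ B / 4 * 1 := by
          refine mul_le_mul_of_nonneg_left ?_ (by positivity)
          rw [div_le_one (by linarith)]; linarith
      _ = _ := mul_one _
  have h4 : B ≤ (exps p T * exps q g) ^ c := by
    rw [hTe]
    exact pow_le_pow_left₀ (by positivity) (mul_le_mul hfμ hgν hν.le (by linarith)) c
  have h5 : exps Q (fun s => f (fun i => (s i).1) * g (fun i => (s i).2)) =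
      exps Q (fun s => T (fun i => (s i).1) * g (fun i => (s i).2)) +
      exps q (fun w => tens (ker Q p q) (fun v => f v - T v) w * g w) := by
    rw [exps_joint h.ker_joint f g, exps_joint h.ker_joint T g, ← exps_add]
    congr 1; funext w
    rw [tens_sub]; ring
  have h6 : (exps q (fun w => tens (ker Q p q) (fun v => f v - T v) w * g w)) ^ 2 ≤ (B / 4) ^ 2 := by
    refine (exps_cs h.q0 _ _).trans ?_
    have e1 := smoothing h.p0 h.p1 h.q0 h.q1 h.ker_nn h.ker_row h.ker_stat h.ker_contr hρ2 hrr0 hrr1 f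
    have e2 := exps_sq_le_one h.p0 h.p1 hf
    have e3 := exps_sq_le_one h.q0 h.q1 hg
    have e4 : 0 ≤ exps q (fun w => tens (ker Q p q) (fun v => f v - T v) w ^ 2) :=
      exps_nonneg h.q0 fun _ => sq_nonneg _
    have e5 : (1 - r * r) / (1 - ρ ^ 2) ≤ (B / 4) ^ 2 := by
      rw [div_le_iff₀ hρ2']; linarith
    have e6 : 0 ≤ (1 - r * r) / (1 - ρ ^ 2) := div_nonneg (by linarith) hρ2'.le
    calc _ ≤ exps q (fun w => tens (ker Q p q) (fun v => f v - T v) w ^ 2) * 1 :=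
          mul_le_mul_of_nonneg_left e3 e4
      _ ≤ (1 - r * r) / (1 - ρ ^ 2) * exps p (fun v => f v ^ 2) := by rw [mul_one]; exact e1
      _ ≤ (1 - r * r) / (1 - ρ ^ 2) * 1 := mul_le_mul_of_nonneg_left e2 e6
      _ ≤ _ := by rw [mul_one]; exact e5
  have h7 := (abs_le.1 (abs_le_of_sq_le_sq h6 (by positivity))).1
  rw [h5]
  linarith

end TwoFun

section Multi
variable {Ω : Type} [Fintype Ω] {ℓ : ℕ}

/-- Rejoin. -/
def rj (j : Fin ℓ) (c : Ω × ({k : Fin ℓ // k ≠ j} → Ω)) : Fin ℓ → Ω := (Equiv.funSplitAt j Ω).symm c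

lemma rj_self (j : Fin ℓ) (c : Ω × ({k : Fin ℓ // k ≠ j} → Ω)) : rj j c j = c.1 := by
  simp [rj, Equiv.funSplitAt, Equiv.piSplitAt]

lemma rj_ne (j : Fin ℓ) (c : Ω × ({k : Fin ℓ // k ≠ j} → Ω)) (k : Fin ℓ) (hk : k ≠ j) :
    rj j c k = c.2 ⟨k, hk⟩ := by
  simp [rj, Equiv.funSplitAt, Equiv.piSplitAt, hk]

/-- The split law. -/
def Qj (P : (Fin ℓ → Ω) → ℝ) (j : Fin ℓ) (c : Ω × ({k : Fin ℓ // k ≠ j} → Ω)) : ℝ := P (rj j c)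

/-- The off-marginal. -/
def qj (P : (Fin ℓ → Ω) → ℝ) (j : Fin ℓ) (w : {k : Fin ℓ // k ≠ j} → Ω) : ℝ := ∑ a, Qj P j (a, w)

lemma sum_rj (j : Fin ℓ) (F : (Fin ℓ → Ω) → ℝ) : ∑ c, F (rj j c) = ∑ x, F x :=
  (Equiv.funSplitAt j Ω).symm.sum_comp F

lemma cov_le_one {P : (Fin ℓ → Ω) → ℝ} (hP : IsDist P) (f g : (Fin ℓ → Ω) → ℝ)
    (hf : varP P f = 1) (hg : varP P g = 1) : covP P f g ≤ 1 := by
  unfold varP covP expP at *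
  set a := ∑ x, P x * f x
  set b := ∑ x, P x * g x
  have h0 : 0 ≤ ∑ x, P x * (f x - g x - (a - b)) ^ 2 :=
    Finset.sum_nonneg fun x _ => mul_nonneg (hP.1 x) (sq_nonneg _)
  have h1 : ∑ x, P x * (f x - g x - (a - b)) ^ 2 =
      ∑ x, P x * (f x * f x) + ∑ x, P x * (g x * g x) - 2 * ∑ x, P x * (f x * g x)
        + (a - b) ^ 2 * ∑ x, P x - 2 * (a - b) * ∑ x, P x * f x + 2 * (a - b) * ∑ x, P x * g x := by
    simp only [Finset.mul_sum, ← Finset.sum_add_distrib, ← Finset.sum_sub_distrib]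
    exact Finset.sum_congr rfl fun x _ => by ring
  rw [h1, hP.2] at h0
  change 0 ≤ _ + _ - _ + _ - 2 * (a - b) * a + 2 * (a - b) * b at h0
  nlinarith

lemma corr_of_rho {P : (Fin ℓ → Ω) → ℝ} {π : Ω → ℝ} (hP : IsDist P) (hm : HasMarginals P π)
    {ρ : ℝ} (hρ : rho P ≤ ρ) (hρ1 : ρ < 1) (hρ0 : 0 < ρ) (j : Fin ℓ) :
    Corr (Qj P j) π (qj P j) ρ := by
  classical
  have hmp : ∀ a, ∑ w, Qj P j (a, w) = π a := by
    intro a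
    rw [← hm j a, marginal, ← sum_rj j, Fintype.sum_prod_type, Finset.sum_eq_single a]
    · simp [rj_self, Qj]
    · intro b _ hb
      simp [rj_self, hb]
    · simp
  have hs1 : ∀ φ : Ω → ℝ, ∑ a, π a * φ a = ∑ x, P x * φ (x j) := by
    intro φ
    rw [← sum_rj j, Fintype.sum_prod_type]
    refine Finset.sum_congr rfl fun a _ => ?_
    simp only [rj_self, ← hmp a, Finset.sum_mul, Qj]
  have hs2 : ∀ φ : ({k : Fin ℓ // k ≠ j} → Ω) → ℝ,
      ∑ w, qj P j w * φ w = ∑ x, P x * φ (fun k => x k) := by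
    intro φ
    rw [← sum_rj j, Fintype.sum_prod_type_right]
    refine Finset.sum_congr rfl fun w _ => ?_
    have : ∀ a, (fun k : {k : Fin ℓ // k ≠ j} => rj j (a, w) k) = w := fun a => by
      funext k; rw [rj_ne j _ k k.2]
    simp only [qj, this, Finset.sum_mul, Qj]
  refine ⟨fun c => hP.1 _, hmp, fun b => rfl, ?_, hρ0, hρ1, fun u v hu hv => ?_⟩
  · have := hs1 (fun _ => 1)
    simp only [mul_one, hP.2] at this
    exact this
  rw [hs1] at hu
  rw [hs2] at hv
  rw [hs1 (fun a => u a ^ 2), hs2 (fun a => v a ^ 2)]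
  have e0 : ∑ c, Qj P j c * (u c.1 * v c.2) = ∑ x, P x * (u (x j) * v (fun k => x k)) := by
    rw [← sum_rj j]
    refine Finset.sum_congr rfl fun c _ => ?_
    have : (fun k : {k : Fin ℓ // k ≠ j} => rj j c k) = c.2 := by
      funext k; rw [rj_ne j _ k k.2]
    rw [this, rj_self]; rfl
  rw [e0]
  set F : (Fin ℓ → Ω) → ℝ := fun x => u (x j) with hF
  set G : (Fin ℓ → Ω) → ℝ := fun x => v (fun k => x k) with hG
  change 2 * ∑ x, P x * (F x * G x) ≤ ρ * (∑ x, P x * F x ^ 2 + ∑ x, P x * G x ^ 2)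
  have hF0 : ∑ x, P x * F x = 0 := hu
  have hG0 : ∑ x, P x * G x = 0 := hv
  set A := ∑ x, P x * F x ^ 2 with hA
  set B := ∑ x, P x * G x ^ 2 with hB
  set D := ∑ x, P x * (F x * G x) with hD
  have hA0 : 0 ≤ A := Finset.sum_nonneg fun x _ => mul_nonneg (hP.1 x) (sq_nonneg _)
  have hB0 : 0 ≤ B := Finset.sum_nonneg fun x _ => mul_nonneg (hP.1 x) (sq_nonneg _)
  have hcs : D ^ 2 ≤ A * B := by
    apply Finset.sum_sq_le_sum_mul_sum_of_sq_le_mul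
    · intro x _; exact mul_nonneg (hP.1 x) (sq_nonneg _)
    · intro x _; exact mul_nonneg (hP.1 x) (sq_nonneg _)
    · intro x _; apply le_of_eq; ring
  by_cases hAB : A * B = 0
  · rw [hAB] at hcs
    have : D = 0 := by
      have := sq_nonneg D
      exact pow_eq_zero_iff (two_ne_zero) |>.1 (le_antisymm hcs this)
    rw [this]
    have := mul_nonneg hρ0.le (add_nonneg hA0 hB0)
    linarith
  have hA1 : 0 < A := lt_of_le_of_ne hA0 fun h => hAB (by rw [← h, zero_mul])
  have hB1 : 0 < B := lt_of_le_of_ne hB0 fun h => hAB (by rw [← h, mul_zero])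
  set a := √A with ha
  set b := √B with hb
  have ha0 : 0 < a := Real.sqrt_pos.2 hA1
  have hb0 : 0 < b := Real.sqrt_pos.2 hB1
  have haA : a ^ 2 = A := Real.sq_sqrt hA0
  have hbB : b ^ 2 = B := Real.sq_sqrt hB0
  have hcovgen : ∀ (F G : (Fin ℓ → Ω) → ℝ) (a b : ℝ), ∑ x, P x * F x = 0 →
      covP P (fun x => F x / a) (fun x => G x / b) = (∑ x, P x * (F x * G x)) / (a * b) := by
    intro F G a b h
    unfold covP expP
    have : ∑ x, P x * (F x / a) = 0 := by
      simp only [← mul_div_assoc, ← Finset.sum_div, h, zero_div]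
    rw [this, zero_mul, sub_zero, Finset.sum_div]
    exact Finset.sum_congr rfl fun x _ => by ring
  have hcov : covP P (fun x => F x / a) (fun x => G x / b) ≤ ρ := by
    refine le_trans ?_ hρ
    refine le_trans (b := rhoST P {j} ({j}ᶜ)) ?_ ?_
    · unfold rhoST
      apply le_csSup
      · refine ⟨1, ?_⟩
        rintro r ⟨f, g, _, _, hf, hg, rfl⟩
        exact cov_le_one hP f g hf hg
      · refine ⟨_, _, ?_, ?_, ?_, ?_, rfl⟩
        · intro x y hxy
          simp only [hF]
          rw [hxy j (by simp)]
        · intro x y hxy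
          simp only [hG]
          congr 2
          funext k
          exact hxy k (by simp [k.2])
        · unfold varP
          rw [hcovgen F F a a hF0]
          have : ∑ x, P x * (F x * F x) = A := Finset.sum_congr rfl fun x _ => by ring
          rw [this, ← haA]; field_simp
        · unfold varP
          rw [hcovgen G G b b hG0]
          have : ∑ x, P x * (G x * G x) = B := Finset.sum_congr rfl fun x _ => by ring
          rw [this, ← hbB]; field_simp
    · exact le_ciSup (f := fun j => rhoST P {j} ({j}ᶜ)) (Set.finite_range _).bddAbove j
  rw [hcovgen F G a b hF0, div_le_iff₀ (by positivity)] at hcov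
  change D ≤ _ at hcov
  rw [← haA, ← hbB]
  nlinarith [mul_nonneg hρ0.le (sq_nonneg (a - b))]

lemma exps_rj {n : ℕ} (P : (Fin ℓ → Ω) → ℝ) (j : Fin ℓ) (F : (Fin n → Fin ℓ → Ω) → ℝ) :
    exps P F = exps (Qj P j) (fun s => F (fun i => rj j (s i))) := by
  unfold exps
  exact ((Equiv.piCongrRight fun _ : Fin n => (Equiv.funSplitAt j Ω).symm).sum_comp
    (fun v => (∏ i, P (v i)) * F v)).symm

lemma Corr.exps_snd {α β : Type} [Fintype α] [Fintype β] {Q : α × β → ℝ} {p : α → ℝ} {q : β → ℝ}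
    {ρ : ℝ} (h : Corr Q p q ρ) {n : ℕ} (g : (Fin n → β) → ℝ) :
    exps Q (fun s => g (fun i => (s i).2)) = exps q g := by
  have := exps_joint h.ker_joint (fun _ : Fin n → α => 1) g
  simp only [one_mul, tens_const h.ker_row] at this
  exact this

lemma prodExp_eq {n : ℕ} (P : (Fin ℓ → Ω) → ℝ) (f : Fin ℓ → ((Fin n → Ω) → ℝ)) :
    prodExp P f = exps P (fun c => ∏ j, f j (fun i => c i j)) := by
  unfold prodExp exps
  exact ((Equiv.piComm (fun (_ : Fin n) (_ : Fin ℓ) => Ω)).sum_comp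
    (fun x => (∏ i, P (fun j => x j i)) * ∏ j, f j (x j))).symm

lemma multi {P : (Fin ℓ → Ω) → ℝ} {π : Ω → ℝ} (hP : IsDist P) {ρ : ℝ}
    (hcorr : ∀ j, Corr (Qj P j) π (qj P j) ρ) {l : ℝ} (hl : 0 < l) (hp : ∀ a, l ≤ π a)
    (m : Fin ℓ → ℝ) (hm : ∀ j, 0 < m j) (S : Finset (Fin ℓ)) :
    ∃ τ δ : ℝ, 0 < τ ∧ 0 < δ ∧ ∀ (n : ℕ) (f : Fin ℓ → ((Fin n → Ω) → ℝ)),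
      (∀ j v, f j v ∈ Set.Icc (0:ℝ) 1) → (∀ j, m j ≤ exps π (f j)) →
      (∀ j i, exps π (fun v => lap π i (f j) v ^ 2) ≤ τ) →
      δ ≤ exps P (fun c => ∏ j ∈ S, f j (fun i => c i j)) := by
  classical
  induction S using Finset.induction_on with
  | empty =>
    refine ⟨1, 1, one_pos, one_pos, fun n f _ _ _ => ?_⟩
    simp only [Finset.prod_empty]
    rw [exps_const hP.2]
  | insert j S hj ih =>
    obtain ⟨τ1, δ1, hτ1, hδ1, h1⟩ := ih
    obtain ⟨τ2, δ2, hτ2, hδ2, h2⟩ := two_fun (hcorr j) hl hp (hm j) hδ1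
    refine ⟨min τ1 τ2, δ2, lt_min hτ1 hτ2, hδ2, fun n f hf hmean hinf => ?_⟩
    set g : (Fin n → {k : Fin ℓ // k ≠ j} → Ω) → ℝ := fun w =>
      ∏ k ∈ S, if h : k = j then 1 else f k (fun i => w i ⟨k, h⟩) with hg
    have hgm : ∀ w, g w ∈ Set.Icc (0:ℝ) 1 := by
      intro w
      have : ∀ k, (if h : k = j then (1:ℝ) else f k (fun i => w i ⟨k, h⟩)) ∈ Set.Icc (0:ℝ) 1 := by
        intro k
        split_ifs
        · simp
        · exact hf _ _
      exact ⟨Finset.prod_nonneg fun k _ => (this k).1,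
        Finset.prod_le_one (fun k _ => (this k).1) (fun k _ => (this k).2)⟩
    have hgS : ∀ s : Fin n → Ω × ({k : Fin ℓ // k ≠ j} → Ω),
        ∏ k ∈ S, f k (fun i => rj j (s i) k) = g (fun i => (s i).2) := by
      intro s
      refine Finset.prod_congr rfl fun k hk => ?_
      have hkj : k ≠ j := fun h => hj (h ▸ hk)
      simp only [hkj, dif_neg, not_false_eq_true, rj_ne j _ k hkj]
    have e1 : exps (qj P j) g = exps P (fun c => ∏ k ∈ S, f k (fun i => c i k)) := by
      rw [exps_rj P j, ← (hcorr j).exps_snd g]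
      simp only [hgS]
    have e2 := h2 n (f j) g (hf j) hgm (hmean j)
      (by rw [e1]; exact h1 n f hf hmean fun j i => (hinf j i).trans (min_le_left _ _))
      (fun i => (hinf j i).trans (min_le_right _ _))
    rw [exps_rj P j]
    simp only [Finset.prod_insert hj, rj_self, hgS]
    exact e2

end Multi

section Incr

lemma resample {α : Type} [Fintype α] {n : ℕ} {p : α → ℝ} (hp1 : ∑ a, p a = 1) (i : Fin n)
    (F : (Fin n → α) → ℝ) :
    exps p F = ∑ a, p a * exps p (fun v => F (Function.update v i a)) := by
  induction n with
  | zero => exact i.elim0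
  | succ n ih =>
    refine Fin.cases ?_ (fun i => ?_) i
    · rw [exps_succ]
      refine Finset.sum_congr rfl fun a _ => ?_
      congr 1
      rw [exps_succ]
      simp only [Fin.update_cons_zero]
      rw [← Finset.sum_mul, hp1, one_mul]
    · rw [exps_succ]
      have : ∀ a, exps p (fun v => F (Function.update v i.succ a)) =
          ∑ b, p b * exps p (fun v => F (Fin.cons b (Function.update v i a))) := by
        intro a
        rw [exps_succ]
        simp only [Fin.cons_update]
      simp only [this]
      have h2 : ∀ b, exps p (fun v => F (Fin.cons b v)) =
          ∑ a, p a * exps p (fun v => F (Fin.cons b (Function.update v i a))) :=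
        fun b => ih i (fun v => F (Fin.cons b v))
      simp only [h2, Finset.mul_sum]
      rw [Finset.sum_comm]
      exact Finset.sum_congr rfl fun a _ => Finset.sum_congr rfl fun b _ => by ring

variable {Ω : Type} [Fintype Ω] {ℓ n : ℕ}

/-- Average over coordinate `i` with weights `κ`. -/
noncomputable def avg (κ : Ω → ℝ) (i : Fin n) (g : (Fin n → Ω) → ℝ) (x : Fin n → Ω) : ℝ :=
  ∑ a, κ a * g (Function.update x i a)

/-- The boosted average. -/
noncomputable def up (κ : Ω → ℝ) (i : Fin n) (g : (Fin n → Ω) → ℝ) (x : Fin n → Ω) : ℝ :=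
  avg κ i g x + (avg κ i (fun y => g y ^ 2) x - avg κ i g x ^ 2)

section
variable {κ : Ω → ℝ} (h0 : ∀ a, 0 ≤ κ a) (h1 : ∑ a, κ a = 1) {g : (Fin n → Ω) → ℝ}
  (hg : ∀ v, g v ∈ Set.Icc (0:ℝ) 1) (i : Fin n) (x : Fin n → Ω)

lemma avg_mem {κ : Ω → ℝ} (h0 : ∀ a, 0 ≤ κ a) (h1 : ∑ a, κ a = 1) {g : (Fin n → Ω) → ℝ}
    (hg : ∀ v, g v ∈ Set.Icc (0:ℝ) 1) (i : Fin n) (x : Fin n → Ω) :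
    avg κ i g x ∈ Set.Icc (0:ℝ) 1 := mean_mem h0 h1 fun _ => hg _

lemma avg_sq_le {κ : Ω → ℝ} (h0 : ∀ a, 0 ≤ κ a) (h1 : ∑ a, κ a = 1) (g : (Fin n → Ω) → ℝ)
    (i : Fin n) (x : Fin n → Ω) :
    avg κ i g x ^ 2 ≤ avg κ i (fun y => g y ^ 2) x := by
  have h := Finset.sum_nonneg (s := Finset.univ) fun (a : Ω) _ =>
    mul_nonneg (h0 a) (sq_nonneg (g (Function.update x i a) - avg κ i g x))
  have e : ∑ a, κ a * (g (Function.update x i a) - avg κ i g x) ^ 2 =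
      avg κ i (fun y => g y ^ 2) x - 2 * avg κ i g x * avg κ i g x + avg κ i g x ^ 2 * ∑ a, κ a := by
    have e2 : ∀ t : ℝ, ∑ a, κ a * (g (Function.update x i a) - t) ^ 2 =
      avg κ i (fun y => g y ^ 2) x - 2 * t * avg κ i g x + t ^ 2 * ∑ a, κ a := by
      intro t
      simp only [avg, Finset.mul_sum, ← Finset.sum_add_distrib, ← Finset.sum_sub_distrib]
      exact Finset.sum_congr rfl fun a _ => by ring
    exact e2 _
  rw [e, h1] at h
  linarith

lemma avg_sq_le' {κ : Ω → ℝ} (h0 : ∀ a, 0 ≤ κ a) {g : (Fin n → Ω) → ℝ}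
    (hg : ∀ v, g v ∈ Set.Icc (0:ℝ) 1) (i : Fin n) (x : Fin n → Ω) :
    avg κ i (fun y => g y ^ 2) x ≤ avg κ i g x := by
  refine Finset.sum_le_sum fun a _ => mul_le_mul_of_nonneg_left ?_ (h0 a)
  have := hg (Function.update x i a)
  nlinarith [this.1, this.2]
end

/-- New functions after a step. -/
noncomputable def nf (κ : Ω → ℝ) (i : Fin n) (j : Fin ℓ) (w : {k : Fin ℓ // k ≠ j} → Ω)
    (f : Fin ℓ → ((Fin n → Ω) → ℝ)) (k : Fin ℓ) : (Fin n → Ω) → ℝ :=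
  if h : k = j then up κ i (f k) else restrOp i (w ⟨k, h⟩) (f k)

/-- All restrictions up to size `N` keep the means large. -/
def Good (π : Ω → ℝ) (m : Fin ℓ → ℝ) (N : ℕ) (f : Fin ℓ → ((Fin n → Ω) → ℝ)) : Prop :=
  ∀ R : Fin n → Option Ω, restSize R ≤ N → ∀ j, m j ≤ exps π (restrict R (f j))

lemma restSize_update (R : Fin n → Option Ω) (i : Fin n) (a : Ω) :
    restSize (Function.update R i (some a)) ≤ restSize R + 1 := by
  unfold restSize
  refine (Finset.card_le_card (t := insert i (Finset.univ.filter (fun i => (R i).isSome = true))) ?_).trans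
    (Finset.card_insert_le _ _)
  intro k hk
  by_cases h : k = i
  · simp [h]
  · simp [Function.update_of_ne h] at hk
    simp [hk]

lemma restrict_restrOp (R : Fin n → Option Ω) (i : Fin n) (a : Ω) (g : (Fin n → Ω) → ℝ) :
    restrict R (restrOp i a g) = restrict (Function.update R i (some a)) g := by
  funext x
  unfold restrict restrOp
  congr 1
  funext k
  by_cases h : k = i
  · subst h; simp
  · simp [Function.update_of_ne h]

lemma nf_mem {κ : Ω → ℝ} (h0 : ∀ a, 0 ≤ κ a) (h1 : ∑ a, κ a = 1) (i : Fin n) (j : Fin ℓ)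
    (w : {k : Fin ℓ // k ≠ j} → Ω) {f : Fin ℓ → ((Fin n → Ω) → ℝ)}
    (hf : ∀ j v, f j v ∈ Set.Icc (0:ℝ) 1) (k : Fin ℓ) (v : Fin n → Ω) :
    nf κ i j w f k v ∈ Set.Icc (0:ℝ) 1 := by
  unfold nf
  split_ifs
  · unfold up
    have a1 := avg_mem h0 h1 (hf k) i v
    have a2 := avg_sq_le h0 h1 (f k) i v
    have a3 := avg_sq_le' h0 (hf k) i v
    constructor
    · linarith [a1.1]
    · nlinarith [sq_nonneg (1 - avg κ i (f k) v)]
  · exact hf _ _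

lemma nf_good {κ : Ω → ℝ} (h0 : ∀ a, 0 ≤ κ a) (h1 : ∑ a, κ a = 1) {π : Ω → ℝ} (hπ : ∀ a, 0 ≤ π a)
    (i : Fin n) (j : Fin ℓ) (m : Fin ℓ → ℝ) (N : ℕ)
    (w : {k : Fin ℓ // k ≠ j} → Ω) {f : Fin ℓ → ((Fin n → Ω) → ℝ)}
    (hG : Good π m (N + 1) f) : Good π m N (nf κ i j w f) := by
  intro R hR k
  have hRa : ∀ a, restSize (Function.update R i (some a)) ≤ N + 1 := fun a =>
    (restSize_update R i a).trans (by omega)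
  unfold nf
  split_ifs with h
  · have e1 : exps π (restrict R (avg κ i (f k))) ≤ exps π (restrict R (up κ i (f k))) := by
      refine exps_mono hπ fun v => ?_
      unfold restrict up
      linarith [avg_sq_le h0 h1 (f k) i (fun i => (R i).getD (v i))]
    refine le_trans ?_ e1
    have e2 : restrict R (avg κ i (f k)) =
        fun v => ∑ a, κ a * restrict (Function.update R i (some a)) (f k) v := by
      funext v
      simp only [← restrict_restrOp]
      rfl
    rw [e2, exps_sum]
    simp only [exps_const_mul]
    calc m k = ∑ a, κ a * m k := by rw [← Finset.sum_mul, h1, one_mul]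
      _ ≤ _ := Finset.sum_le_sum fun a _ => mul_le_mul_of_nonneg_left (hG _ (hRa a) k) (h0 a)
  · rw [restrict_restrOp]
    exact hG _ (hRa _) k

variable {P : (Fin ℓ → Ω) → ℝ} {π : Ω → ℝ} {ρ : ℝ}

lemma nf_prod (hP : IsDist P) (j : Fin ℓ) (hc : Corr (Qj P j) π (qj P j) ρ) (i : Fin n)
    (w : {k : Fin ℓ // k ≠ j} → Ω) {f : Fin ℓ → ((Fin n → Ω) → ℝ)}
    (hf : ∀ j v, f j v ∈ Set.Icc (0:ℝ) 1) :
    qj P j w / 2 * exps P (fun c => ∏ k, nf (ker (Qj P j) π (qj P j) w) i j w f k (fun i => c i k)) ≤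
      exps P (fun c => ∏ k, f k (fun i => c i k)) := by
  classical
  set κ := ker (Qj P j) π (qj P j) w with hκ
  set q := qj P j w with hq
  have h0 : ∀ a, 0 ≤ κ a := hc.ker_nn w
  have h1 : ∑ a, κ a = 1 := hc.ker_row w
  rw [resample hP.2 i (fun c => ∏ k, f k (fun i => c i k)), ← sum_rj j, Fintype.sum_prod_type_right]
  set G : (Fin n → Fin ℓ → Ω) → Ω → ℝ := fun c a =>
    f j (Function.update (fun i => c i j) i a) *
      ∏ k ∈ Finset.univ.erase j, nf κ i j w f k (fun i => c i k) with hG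
  have hupd : ∀ (c : Fin n → Fin ℓ → Ω) (x : Fin ℓ → Ω) (k : Fin ℓ),
      (fun i' => Function.update c i x i' k) = Function.update (fun i => c i k) i (x k) := by
    intro c x k
    funext i'
    by_cases h : i' = i
    · subst h; simp
    · simp [Function.update_of_ne h]
  have hprod : ∀ (c : Fin n → Fin ℓ → Ω) (a : Ω),
      ∏ k, f k (fun i' => Function.update c i (rj j (a, w)) i' k) = G c a := by
    intro c a
    simp only [hupd]
    rw [← Finset.mul_prod_erase _ _ (Finset.mem_univ j), rj_self]
    simp only [hG]
    congr 1
    refine Finset.prod_congr rfl fun k hk => ?_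
    have hkj : k ≠ j := Finset.ne_of_mem_erase hk
    rw [rj_ne j _ k hkj]
    simp only [nf, hkj, dif_neg, not_false_eq_true]
    rfl
  have hE0 : ∀ (x : Fin ℓ → Ω),
      0 ≤ P x * exps P (fun c => ∏ k, f k (fun i' => Function.update c i x i' k)) := fun x =>
    mul_nonneg (hP.1 x) (exps_nonneg hP.1 fun c => Finset.prod_nonneg fun k _ => (hf _ _).1)
  refine le_trans ?_ (Finset.single_le_sum (f := fun w => ∑ a, P (rj j (a, w)) *
    exps P (fun c => ∏ k, f k (fun i' => Function.update c i (rj j (a, w)) i' k)))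
    (fun w _ => Finset.sum_nonneg fun a _ => hE0 _) (Finset.mem_univ w))
  simp only [hprod]
  have e1 : ∀ a, P (rj j (a, w)) = q * κ a := fun a => (hc.ker_joint a w).symm
  have e2 : ∑ a, P (rj j (a, w)) * exps P (fun c => G c a) = q * exps P (fun c => ∑ a, κ a * G c a) := by
    rw [exps_sum, Finset.mul_sum]
    refine Finset.sum_congr rfl fun a _ => ?_
    rw [e1, exps_const_mul]; ring
  rw [e2, div_mul_eq_mul_div, mul_div_assoc]
  refine mul_le_mul_of_nonneg_left ?_ (hc.q0 w)
  rw [div_le_iff₀ two_pos, mul_comm, ← exps_const_mul]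
  refine exps_mono hP.1 fun c => ?_
  rw [← Finset.mul_prod_erase _ _ (Finset.mem_univ j)]
  simp only [hG, ← mul_assoc, ← Finset.sum_mul]
  refine mul_le_mul_of_nonneg_right ?_ (Finset.prod_nonneg fun k _ => (nf_mem h0 h1 i j w hf k _).1)
  simp only [nf, dif_pos]
  have a3 := avg_sq_le' h0 (hf j) i (fun i => c i j)
  have a4 := sq_nonneg (avg κ i (f j) (fun i => c i j))
  unfold up
  change _ ≤ 2 * avg κ i (f j) (fun i => c i j)
  linarith

end Incr

section Fin1

lemma Corr.ker_avg {α β : Type} [Fintype α] [Fintype β] {Q : α × β → ℝ} {p : α → ℝ} {q : β → ℝ}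
    {ρ : ℝ} (h : Corr Q p q ρ) (φ : α → ℝ) :
    ∑ b, q b * ∑ a, ker Q p q b a * φ a = ∑ a, p a * φ a := by
  simp only [Finset.mul_sum]
  rw [Finset.sum_comm]
  refine Finset.sum_congr rfl fun a _ => ?_
  rw [← h.ker_stat a, Finset.sum_mul]
  exact Finset.sum_congr rfl fun b _ => by ring

lemma Corr.boost {α β : Type} [Fintype α] [Fintype β] {Q : α × β → ℝ} {p : α → ℝ} {q : β → ℝ}
    {ρ : ℝ} (h : Corr Q p q ρ) (φ : α → ℝ) :
    ∑ a, p a * φ a + (1 - ρ ^ 2) * ∑ a, p a * (φ a - ∑ x, p x * φ x) ^ 2 ≤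
    ∑ b, q b * (∑ a, ker Q p q b a * φ a +
      (∑ a, ker Q p q b a * φ a ^ 2 - (∑ a, ker Q p q b a * φ a) ^ 2)) := by
  set m := ∑ x, p x * φ x with hm
  have hu0 : ∑ a, p a * (φ a - m) = 0 := by
    simp only [mul_sub, Finset.sum_sub_distrib, ← Finset.sum_mul, h.p1, ← hm]; ring
  have h1 := h.ker_contr (fun a => φ a - m) hu0
  have e1 : ∀ b, ∑ a, ker Q p q b a * φ a = ∑ a, ker Q p q b a * (φ a - m) + m := by
    intro b
    simp only [mul_sub, Finset.sum_sub_distrib, ← Finset.sum_mul, h.ker_row]; ring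
  have e2 : ∑ b, q b * (∑ a, ker Q p q b a * φ a) ^ 2 =
      ∑ b, q b * (∑ a, ker Q p q b a * (φ a - m)) ^ 2 + m ^ 2 := by
    have : ∀ b, q b * (∑ a, ker Q p q b a * φ a) ^ 2 =
        q b * (∑ a, ker Q p q b a * (φ a - m)) ^ 2 +
        2 * m * (q b * ∑ a, ker Q p q b a * (φ a - m)) + m ^ 2 * q b := by
      intro b; rw [e1]; ring
    simp only [this, Finset.sum_add_distrib, ← Finset.mul_sum, h.q1]
    rw [h.ker_avg (fun a => φ a - m), hu0]; ring
  have e3 : ∑ a, p a * φ a ^ 2 = ∑ a, p a * (φ a - m) ^ 2 + m ^ 2 := by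
    have : ∀ a, p a * φ a ^ 2 = p a * (φ a - m) ^ 2 + 2 * m * (p a * (φ a - m)) + m ^ 2 * p a := by
      intro a; ring
    simp only [this, Finset.sum_add_distrib, ← Finset.mul_sum, h.p1, hu0]; ring
  simp only [mul_add, mul_sub, Finset.sum_add_distrib, Finset.sum_sub_distrib]
  rw [h.ker_avg φ, h.ker_avg (fun a => φ a ^ 2), e2, e3]
  linarith

variable {Ω : Type} [Fintype Ω] {ℓ n : ℕ} {P : (Fin ℓ → Ω) → ℝ} {π : Ω → ℝ} {ρ : ℝ}

lemma exps_avg (hπ1 : ∑ a, π a = 1) (i : Fin n) (g : (Fin n → Ω) → ℝ) :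
    exps π (fun x => ∑ a, π a * g (Function.update x i a)) = exps π g := by
  rw [exps_sum, resample hπ1 i g]
  simp only [exps_const_mul]

lemma nf_means (hc : ∀ j, Corr (Qj P j) π (qj P j) ρ) (i : Fin n) (j : Fin ℓ)
    (f : Fin ℓ → ((Fin n → Ω) → ℝ)) :
    ∑ k, exps π (f k) + (1 - ρ ^ 2) * exps π (fun v => lap π i (f j) v ^ 2) ≤
      ∑ w, qj P j w * ∑ k, exps π (nf (ker (Qj P j) π (qj P j) w) i j w f k) := by
  classical
  simp only [Finset.mul_sum]
  rw [Finset.sum_comm, ← Finset.add_sum_erase _ _ (Finset.mem_univ j),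
    ← Finset.add_sum_erase (a := j) _ _ (Finset.mem_univ j)]
  have hne : ∀ k ∈ Finset.univ.erase j, exps π (f k) =
      ∑ w, qj P j w * exps π (nf (ker (Qj P j) π (qj P j) w) i j w f k) := by
    intro k hk
    have hkj : k ≠ j := Finset.ne_of_mem_erase hk
    simp only [nf, hkj, dif_neg, not_false_eq_true]
    rw [← (hc j).snd (fun w => exps π (restrOp i (w ⟨k, hkj⟩) (f k)))]
    have e1 : ∀ c, Qj P j c * exps π (restrOp i (c.2 ⟨k, hkj⟩) (f k)) =
        (fun x => P x * exps π (restrOp i (x k) (f k))) (rj j c) := by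
      intro c
      simp only [rj_ne j _ k hkj]; rfl
    simp only [e1]
    rw [sum_rj j (fun x => P x * exps π (restrOp i (x k) (f k))), ← sum_rj k]
    simp only [rj_self]
    have := (hc k).fst (fun a => exps π (restrOp i a (f k)))
    rw [resample (hc k).p1 i (f k)]
    exact this.symm
  rw [Finset.sum_congr rfl hne]
  suffices h : exps π (f j) + (1 - ρ ^ 2) * exps π (fun v => lap π i (f j) v ^ 2) ≤
      ∑ w, qj P j w * exps π (nf (ker (Qj P j) π (qj P j) w) i j w f j) by linarith
  simp only [nf, dif_pos]
  have e2 : ∑ w, qj P j w * exps π (up (ker (Qj P j) π (qj P j) w) i (f j)) =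
      exps π (fun x => ∑ w, qj P j w * up (ker (Qj P j) π (qj P j) w) i (f j) x) := by
    rw [exps_sum]; simp only [exps_const_mul]
  rw [e2]
  have e3 : exps π (f j) + (1 - ρ ^ 2) * exps π (fun v => lap π i (f j) v ^ 2) =
      exps π (fun x => ∑ a, π a * f j (Function.update x i a) + (1 - ρ ^ 2) *
        ∑ a, π a * (f j (Function.update x i a) - ∑ b, π b * f j (Function.update x i b)) ^ 2) := by
    rw [exps_add, exps_const_mul, exps_avg (hc j).p1]
    rw [← exps_avg (hc j).p1 i (fun v => lap π i (f j) v ^ 2)]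
    simp only [lap, Function.update_idem]
  rw [e3]
  refine exps_mono (hc j).p0 fun x => ?_
  exact (hc j).boost (fun a => f j (Function.update x i a))

lemma exists_step (hP : IsDist P) (hc : ∀ j, Corr (Qj P j) π (qj P j) ρ) (i : Fin n) (j : Fin ℓ)
    {f : Fin ℓ → ((Fin n → Ω) → ℝ)} (hf : ∀ j v, f j v ∈ Set.Icc (0:ℝ) 1) {η q0 : ℝ}
    (hη : η ≤ (1 - ρ ^ 2) * exps π (fun v => lap π i (f j) v ^ 2))
    (hq0 : 0 < q0) (hq : ∀ w, qj P j w = 0 ∨ q0 ≤ qj P j w) (m : Fin ℓ → ℝ) (N : ℕ)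
    (hG : Good π m (N + 1) f) :
    ∃ f' : Fin ℓ → ((Fin n → Ω) → ℝ), (∀ j v, f' j v ∈ Set.Icc (0:ℝ) 1) ∧ Good π m N f' ∧
      ∑ k, exps π (f k) + η ≤ ∑ k, exps π (f' k) ∧
      q0 / 2 * exps P (fun c => ∏ k, f' k (fun i => c i k)) ≤
        exps P (fun c => ∏ k, f k (fun i => c i k)) := by
  have hmeans := nf_means hc i j f
  obtain ⟨w, hw, hMw⟩ : ∃ w, qj P j w ≠ 0 ∧ ∑ k, exps π (f k) + η ≤
      ∑ k, exps π (nf (ker (Qj P j) π (qj P j) w) i j w f k) := by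
    by_contra hcon
    push Not at hcon
    set M := fun w => ∑ k, exps π (nf (ker (Qj P j) π (qj P j) w) i j w f k) with hM
    set T := ∑ k, exps π (f k) + η with hT
    have hnn : ∀ w ∈ Finset.univ, 0 ≤ qj P j w * (T - M w) := by
      intro w _
      by_cases h : qj P j w = 0
      · simp [h]
      · exact mul_nonneg ((hc j).q0 w) (by linarith [hcon w h])
    have hsum : ∑ w, qj P j w * (T - M w) ≤ 0 := by
      simp only [mul_sub, Finset.sum_sub_distrib, ← Finset.sum_mul, (hc j).q1]
      linarith
    have hz := (Finset.sum_eq_zero_iff_of_nonneg hnn).1 (le_antisymm hsum (Finset.sum_nonneg hnn))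
    have hall : ∀ w, qj P j w = 0 := by
      intro w
      by_contra h
      rcases mul_eq_zero.1 (hz w (Finset.mem_univ w)) with h' | h'
      · exact h h'
      · linarith [hcon w h]
    have := (hc j).q1
    simp [hall] at this
  have h0 := (hc j).ker_nn w
  have h1 := (hc j).ker_row w
  refine ⟨_, nf_mem h0 h1 i j w hf, nf_good h0 h1 (hc j).p0 i j m N w hG, hMw, ?_⟩
  refine le_trans ?_ (nf_prod hP j (hc j) i w hf)
  refine mul_le_mul_of_nonneg_right ?_
    (exps_nonneg hP.1 fun c => Finset.prod_nonneg fun k _ => (nf_mem h0 h1 i j w hf k _).1)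
  have := (hq w).resolve_left hw
  linarith

lemma induct (hP : IsDist P) (hc : ∀ j, Corr (Qj P j) π (qj P j) ρ) (m : Fin ℓ → ℝ)
    {τ δ0 η q0 : ℝ} (hδ0 : 0 < δ0) (hq0 : 0 < q0) (hρ : 0 ≤ 1 - ρ ^ 2) (hη : η = (1 - ρ ^ 2) * τ)
    (hq : ∀ j w, qj P j w = 0 ∨ q0 ≤ qj P j w)
    (hmul : ∀ (n : ℕ) (f : Fin ℓ → ((Fin n → Ω) → ℝ)),
      (∀ j v, f j v ∈ Set.Icc (0:ℝ) 1) → (∀ j, m j ≤ exps π (f j)) →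
      (∀ j i, exps π (fun v => lap π i (f j) v ^ 2) ≤ τ) →
      δ0 ≤ exps P (fun c => ∏ j, f j (fun i => c i j))) (N : ℕ) :
    ∃ δ : ℝ, 0 < δ ∧ ∀ (n : ℕ) (f : Fin ℓ → ((Fin n → Ω) → ℝ)),
      (∀ j v, f j v ∈ Set.Icc (0:ℝ) 1) → Good π m N f → ℓ - N * η < ∑ k, exps π (f k) →
      δ ≤ exps P (fun c => ∏ j, f j (fun i => c i j)) := by
  induction N with
  | zero =>
    refine ⟨1, one_pos, fun n f hf _ h => ?_⟩
    exfalso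
    have : ∑ k, exps π (f k) ≤ ∑ k : Fin ℓ, (1:ℝ) :=
      Finset.sum_le_sum fun k _ => (exps_mem (hc k).p0 (hc k).p1 (hf k)).2
    simp at this h
    linarith
  | succ N ih =>
    obtain ⟨δ, hδ, ih⟩ := ih
    refine ⟨min δ0 (q0 / 2 * δ), lt_min hδ0 (by positivity), fun n f hf hG hM => ?_⟩
    by_cases hinf : ∀ j i, exps π (fun v => lap π i (f j) v ^ 2) ≤ τ
    · refine (min_le_left _ _).trans (hmul n f hf (fun j => ?_) hinf)
      have := hG (fun _ => none) (by simp [restSize]) j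
      exact this
    · push Not at hinf
      obtain ⟨j, i, hij⟩ := hinf
      obtain ⟨f', hf', hG', hM', hp'⟩ := exists_step hP hc i j hf (η := η)
        (by rw [hη]; exact mul_le_mul_of_nonneg_left hij.le hρ) hq0 (hq j) m N hG
      refine (min_le_right _ _).trans (le_trans ?_ hp')
      refine mul_le_mul_of_nonneg_left (ih n f' hf' hG' ?_) (by positivity)
      push_cast at hM
      linarith

end Fin1
/-- set hitting for resilient functions. -/
theorem resilient_set_hitting
    {Ω : Type} [Fintype Ω] {ℓ : ℕ}
    (P : (Fin ℓ → Ω) → ℝ) (π : Ω → ℝ)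
    (hP : IsDist P) (hm : HasMarginals P π) (hπ : ∀ a : Ω, 0 < π a)
    (ρ : ℝ) (hρ : rho P ≤ ρ) (hρ1 : ρ < 1)
    (ε : ℝ) (hε : ε ∈ Set.Ico (0:ℝ) 1)
    (μ : Fin ℓ → ℝ) (hμ : ∀ j, μ j ∈ Set.Ioc (0:ℝ) 1) :
    ∃ (k : ℕ) (δ : ℝ), 0 < δ ∧
      ∀ n : ℕ, 1 ≤ n →
      ∀ f : Fin ℓ → ((Fin n → Ω) → ℝ),
        (∀ j v, f j v ∈ Set.Icc (0:ℝ) 1) →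
        (∀ j, exps π (f j) = μ j) →
        (∀ j, Resilient π ε k (f j)) →
        δ ≤ prodExp P f := by
  have hr1 : max ρ (1 / 2) < 1 := max_lt hρ1 (by norm_num)
  have hr0 : 0 < max ρ (1 / 2) := lt_max_of_lt_right (by norm_num)
  have hc : ∀ j, Corr (Qj P j) π (qj P j) (max ρ (1 / 2)) := fun j =>
    corr_of_rho hP hm (hρ.trans (le_max_left _ _)) hr1 hr0 j
  set r := max ρ (1 / 2) with hr
  obtain ⟨l, hl, -, hlπ⟩ := exists_min_pos π fun a => (hπ a).le
  have hlπ' : ∀ a, l ≤ π a := fun a => (hlπ a).resolve_left (hπ a).ne'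
  have hm0 : ∀ j, 0 < (1 - ε) * μ j := fun j => mul_pos (by linarith [hε.2]) (hμ j).1
  obtain ⟨τ, δ0, hτ, hδ0, hmul⟩ := multi hP hc hl hlπ' (fun j => (1 - ε) * μ j) hm0 Finset.univ
  obtain ⟨q0, hq0, -, hq⟩ := exists_min_pos (fun s : Σ j : Fin ℓ, ({k : Fin ℓ // k ≠ j} → Ω) =>
    qj P s.1 s.2) (fun s => (hc s.1).q0 s.2)
  have hr2 : 0 < 1 - r ^ 2 := by nlinarith
  have hη : 0 < (1 - r ^ 2) * τ := mul_pos hr2 hτ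
  obtain ⟨N, hN⟩ := exists_nat_gt (ℓ / ((1 - r ^ 2) * τ))
  rw [div_lt_iff₀ hη] at hN
  obtain ⟨δ, hδ, hind⟩ := induct hP hc (fun j => (1 - ε) * μ j) hδ0 hq0 hr2.le rfl
    (fun j w => hq ⟨j, w⟩) hmul N
  refine ⟨N, δ, hδ, fun n _ f hf hmean hres => ?_⟩
  rw [prodExp_eq]
  refine hind n f hf (fun R hR j => ?_) ?_
  · have := (hres j R hR).1
    rwa [hmean j] at this
  · have : 0 ≤ ∑ k, exps π (f k) :=
      Finset.sum_nonneg fun k _ => by rw [hmean k]; exact (hμ k).1.le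
    linarith

end SameSetHitting
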